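/- arXiv:2309.02325 — 3 statements merged into one kernel-verified Lean document; each statement's English description precedes it below -/
import Mathlib

section
/- There exist absolute constants C, c > 0 such that for all reals 2 ≤ z ≤ y, one has ∑_{z ≤ p ≤ y, p prime} 1/p ≤ C · (exp(−c·√(log z)) + log(y/z)) / log z. -/
open Finset ArithmeticFunction in
theorem sum_moebius_filter_dvd {k l : ℕ} (hl : Squarefree l) :
    ∑ d ∈ l.divisors with k ∣ d, (moebius d : ℝ) = if k = l then (moebius k : ℝ) else 0 := by
  have hl0 : l ≠ 0 := hl.ne_zero
  by_cases hkl : k ∣ l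
  · obtain ⟨m, rfl⟩ := hkl
    have hk : k ≠ 0 := left_ne_zero_of_mul hl0
    have hm : m ≠ 0 := right_ne_zero_of_mul hl0
    have hcop : k.Coprime m := Nat.coprime_of_squarefree_mul hl
    have himage : {d ∈ (k * m).divisors | k ∣ d} = m.divisors.image (k * ·) := by
      ext d
      simp only [mem_filter, Nat.mem_divisors, mem_image]
      constructor
      · rintro ⟨⟨hd, -⟩, e, rfl⟩
        exact ⟨e, ⟨Nat.dvd_of_mul_dvd_mul_left (Nat.pos_of_ne_zero hk) hd, hm⟩, rfl⟩
      · rintro ⟨e, ⟨he, -⟩, rfl⟩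
        exact ⟨⟨mul_dvd_mul_left k he, hl0⟩, dvd_mul_right k e⟩
    have hsum : ∑ e ∈ m.divisors, (moebius e : ℝ) = if m = 1 then 1 else 0 := by
      have h := congrArg (fun f : ArithmeticFunction ℤ => f m) coe_zeta_mul_moebius
      simp only [coe_zeta_mul_apply, one_apply] at h
      exact_mod_cast h
    rw [himage, sum_image fun a _ b _ h => Nat.eq_of_mul_eq_mul_left (Nat.pos_of_ne_zero hk) h]
    have hterm : ∀ e ∈ m.divisors, (moebius (k * e) : ℝ) = moebius k * moebius e := by
      intro e he
      rw [isMultiplicative_moebius.map_mul_of_coprime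
        (hcop.coprime_dvd_right (Nat.dvd_of_mem_divisors he))]
      push_cast
      rfl
    rw [sum_congr rfl hterm, ← mul_sum, hsum]
    have : k = k * m ↔ m = 1 := by
      rw [eq_comm, Nat.mul_eq_left hk]
    simp [this]
  · rw [if_neg fun h : k = l => hkl h.dvd, sum_eq_zero]
    intro d hd
    simp only [mem_filter, Nat.mem_divisors] at hd
    exact absurd (hd.2.trans hd.1.1) hkl

/-- The reciprocal of a squarefree number, extended by zero. -/
noncomputable def squarefreeRecip (l : ℕ) : ℝ := if Squarefree l then (l : ℝ)⁻¹ else 0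

theorem squarefreeRecip_nonneg (l : ℕ) : 0 ≤ squarefreeRecip l := by
  unfold squarefreeRecip; positivity

/-- The sum of the reciprocals of the squarefree numbers up to `R`. -/
noncomputable def squarefreeRecipSum (R : ℕ) : ℝ := ∑ l ∈ Finset.Icc 1 R, squarefreeRecip l

open Finset in
theorem log_le_two_mul_squarefreeRecipSum (R : ℕ) :
    Real.log (R + 1 : ℕ) ≤ 2 * squarefreeRecipSum R := by
  have hharm : Real.log (R + 1 : ℕ) ≤ ∑ n ∈ Icc 1 R, (n : ℝ)⁻¹ := by
    simpa [harmonic_eq_sum_Icc] using log_add_one_le_harmonic R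
  have hsq : ∑ b ∈ Icc 1 R, ((b : ℝ) ^ 2)⁻¹ ≤ 2 := by
    have h := sum_Ioo_inv_sq_le (α := ℝ) 0 (R + 1)
    have hI : Ioo 0 (R + 1) = Icc 1 R := by ext; simp; omega
    rw [hI] at h
    simpa using h
  have hdecomp : ∀ n : ℕ, ∃ q : ℕ × ℕ, q.1 ^ 2 * q.2 = n ∧ Squarefree q.2 := fun n => by
    obtain ⟨a, b, h⟩ := Nat.sq_mul_squarefree n
    exact ⟨(b, a), h⟩
  choose q hq hqs using hdecomp
  have hinj : Function.Injective q := fun m n h => by rw [← hq m, ← hq n, h]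
  have hle : ∑ n ∈ Icc 1 R, (n : ℝ)⁻¹ ≤
      ∑ v ∈ Icc 1 R ×ˢ Icc 1 R, ((v.1 : ℝ) ^ 2)⁻¹ * squarefreeRecip v.2 := by
    calc ∑ n ∈ Icc 1 R, (n : ℝ)⁻¹
        = ∑ n ∈ Icc 1 R, (((q n).1 : ℝ) ^ 2)⁻¹ * squarefreeRecip (q n).2 := by
          refine sum_congr rfl fun n _ => ?_
          rw [squarefreeRecip, if_pos (hqs n), ← mul_inv]
          exact_mod_cast congrArg (fun k : ℕ => (k : ℝ)⁻¹) (hq n).symm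
      _ = ∑ v ∈ (Icc 1 R).image q, ((v.1 : ℝ) ^ 2)⁻¹ * squarefreeRecip v.2 :=
          (sum_image (f := fun v : ℕ × ℕ => ((v.1 : ℝ) ^ 2)⁻¹ * squarefreeRecip v.2)
            hinj.injOn).symm
      _ ≤ _ := by
          refine sum_le_sum_of_subset_of_nonneg ?_ fun v _ _ =>
            mul_nonneg (by positivity) (squarefreeRecip_nonneg _)
          intro v hv
          obtain ⟨n, hn, rfl⟩ := mem_image.1 hv
          rw [mem_Icc] at hn
          have h0 : (q n).1 ^ 2 * (q n).2 ≠ 0 := by rw [hq n]; omega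
          have h1 : (q n).1 ≠ 0 := fun h => h0 (by simp [h])
          have h2 : (q n).2 ≠ 0 := fun h => h0 (by simp [h])
          have hd1 : (q n).1 ∣ n :=
            (dvd_pow_self _ two_ne_zero).trans ((dvd_mul_right _ _).trans (hq n).dvd)
          have hd2 : (q n).2 ∣ n := (dvd_mul_left _ _).trans (hq n).dvd
          have := Nat.le_of_dvd (by omega) hd1
          have := Nat.le_of_dvd (by omega) hd2
          simp only [mem_product, mem_Icc]
          omega
  simp only [sum_product] at hle
  rw [← sum_mul_sum] at hle
  have hS : 0 ≤ squarefreeRecipSum R := sum_nonneg fun l _ => squarefreeRecip_nonneg l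
  calc Real.log (R + 1 : ℕ) ≤ _ := hharm
    _ ≤ _ := hle
    _ ≤ 2 * squarefreeRecipSum R := mul_le_mul_of_nonneg_right hsq hS

/-- Unnormalised Selberg sieve weights of level `R`. -/
noncomputable def sieveWeight (R d : ℕ) : ℝ :=
  ArithmeticFunction.moebius d * d * ∑ l ∈ Finset.Icc 1 R with d ∣ l, squarefreeRecip l

theorem sieveWeight_one (R : ℕ) : sieveWeight R 1 = squarefreeRecipSum R := by
  simp [sieveWeight, squarefreeRecipSum]

open Finset in
theorem abs_sieveWeight_le (R d : ℕ) : |sieveWeight R d| ≤ d * squarefreeRecipSum R := by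
  have hμ : |(ArithmeticFunction.moebius d : ℝ)| ≤ 1 := by
    exact_mod_cast ArithmeticFunction.abs_moebius_le_one (n := d)
  have h0 : 0 ≤ ∑ l ∈ Icc 1 R with d ∣ l, squarefreeRecip l :=
    sum_nonneg fun l _ => squarefreeRecip_nonneg l
  have h1 : ∑ l ∈ Icc 1 R with d ∣ l, squarefreeRecip l ≤ squarefreeRecipSum R :=
    sum_le_sum_of_subset_of_nonneg (filter_subset _ _) fun l _ _ => squarefreeRecip_nonneg l
  rw [sieveWeight, abs_mul, abs_mul, Nat.abs_cast, abs_of_nonneg h0]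
  exact mul_le_mul (mul_le_of_le_one_left d.cast_nonneg hμ) h1 h0 d.cast_nonneg

open Finset in
theorem sum_abs_sieveWeight_le (R : ℕ) :
    ∑ d ∈ Icc 1 R, |sieveWeight R d| ≤ R ^ 2 * squarefreeRecipSum R := by
  have hS : 0 ≤ squarefreeRecipSum R := sum_nonneg fun l _ => squarefreeRecip_nonneg l
  calc ∑ d ∈ Icc 1 R, |sieveWeight R d|
      ≤ ∑ d ∈ Icc 1 R, R * squarefreeRecipSum R := by
        refine sum_le_sum fun d hd => (abs_sieveWeight_le R d).trans ?_
        have : d ≤ R := (mem_Icc.1 hd).2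
        gcongr
    _ = R ^ 2 * squarefreeRecipSum R := by
        simp only [sum_const, Nat.card_Icc, nsmul_eq_mul, Nat.add_sub_cancel]
        ring

open Finset in
theorem sum_sieveWeight_div {R k : ℕ} (hk : k ∈ Icc 1 R) :
    ∑ d ∈ Icc 1 R with k ∣ d, sieveWeight R d / d =
      ArithmeticFunction.moebius k * squarefreeRecip k := by
  have hterm : ∀ d ∈ Icc 1 R, (if k ∣ d then sieveWeight R d / d else 0) =
      ∑ l ∈ Icc 1 R, if k ∣ d ∧ d ∣ l then
        (ArithmeticFunction.moebius d : ℝ) * squarefreeRecip l else 0 := by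
    intro d hd
    have hd0 : (d : ℝ) ≠ 0 := by
      have := (mem_Icc.1 hd).1
      positivity
    by_cases hkd : k ∣ d
    · simp only [hkd, true_and, if_true]
      rw [sieveWeight, ← sum_filter, ← mul_sum]
      field_simp
    · simp [hkd]
  rw [sum_filter, sum_congr rfl hterm, sum_comm]
  have hinner : ∀ l ∈ Icc 1 R, (∑ d ∈ Icc 1 R, if k ∣ d ∧ d ∣ l then
      (ArithmeticFunction.moebius d : ℝ) * squarefreeRecip l else 0) =
      if k = l then ArithmeticFunction.moebius k * squarefreeRecip l else 0 := by
    intro l hl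
    by_cases hsf : Squarefree l
    · have hfilter : {d ∈ Icc 1 R | k ∣ d ∧ d ∣ l} = {d ∈ l.divisors | k ∣ d} := by
        ext d
        simp only [mem_filter, mem_Icc, Nat.mem_divisors] at hl ⊢
        constructor
        · rintro ⟨-, h1, h2⟩
          exact ⟨⟨h2, by omega⟩, h1⟩
        · rintro ⟨⟨h1, h2⟩, h3⟩
          exact ⟨⟨Nat.pos_of_dvd_of_pos h1 hl.1, (Nat.le_of_dvd hl.1 h1).trans hl.2⟩, h3, h1⟩
      rw [← sum_filter, hfilter, ← sum_mul, sum_moebius_filter_dvd hsf, ite_mul, zero_mul]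
    · simp [squarefreeRecip, hsf]
  rw [sum_congr rfl hinner, sum_ite_eq, if_pos hk]

open Finset in
theorem sum_sieveWeight_mul_div_lcm_le (R : ℕ) :
    ∑ d ∈ Icc 1 R, ∑ e ∈ Icc 1 R, sieveWeight R d * sieveWeight R e / (d.lcm e : ℝ) ≤
      squarefreeRecipSum R := by
  have hterm : ∀ d ∈ Icc 1 R, ∀ e ∈ Icc 1 R,
      sieveWeight R d * sieveWeight R e / (d.lcm e : ℝ) =
      ∑ k ∈ Icc 1 R, (k.totient : ℝ) * ((if k ∣ d then sieveWeight R d / d else 0) *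
        (if k ∣ e then sieveWeight R e / e else 0)) := by
    intro d hd e he
    rw [mem_Icc] at hd he
    have hd0 : (d : ℝ) ≠ 0 := by have := hd.1; positivity
    have he0 : (e : ℝ) ≠ 0 := by have := he.1; positivity
    have hfilter : {k ∈ Icc 1 R | k ∣ d ∧ k ∣ e} = (d.gcd e).divisors := by
      ext k
      simp only [mem_filter, mem_Icc, Nat.mem_divisors, Nat.dvd_gcd_iff]
      constructor
      · rintro ⟨-, h⟩
        exact ⟨h, (Nat.gcd_pos_of_pos_left e hd.1).ne'⟩
      · rintro ⟨h, -⟩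
        exact ⟨⟨Nat.pos_of_dvd_of_pos h.1 hd.1, (Nat.le_of_dvd hd.1 h.1).trans hd.2⟩, h⟩
    have hgcd : (∑ k ∈ (d.gcd e).divisors, (k.totient : ℝ)) = d.gcd e := by
      exact_mod_cast Nat.sum_totient (d.gcd e)
    have hlcm : (d.gcd e : ℝ) * d.lcm e = d * e := by exact_mod_cast Nat.gcd_mul_lcm d e
    have hlcm0 : (d.lcm e : ℝ) ≠ 0 := right_ne_zero_of_mul (hlcm ▸ mul_ne_zero hd0 he0)
    have hsum : ∑ k ∈ Icc 1 R, (k.totient : ℝ) * ((if k ∣ d then sieveWeight R d / d else 0) *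
        (if k ∣ e then sieveWeight R e / e else 0)) =
        (∑ k ∈ Icc 1 R with k ∣ d ∧ k ∣ e, (k.totient : ℝ)) *
          (sieveWeight R d / d * (sieveWeight R e / e)) := by
      rw [sum_mul, sum_filter]
      refine sum_congr rfl fun k _ => ?_
      by_cases h1 : k ∣ d <;> by_cases h2 : k ∣ e <;> simp [h1, h2]
    rw [hsum, hfilter, hgcd]
    field_simp
    rw [mul_assoc, ← hlcm]
    ring
  calc ∑ d ∈ Icc 1 R, ∑ e ∈ Icc 1 R, sieveWeight R d * sieveWeight R e / (d.lcm e : ℝ)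
      = ∑ d ∈ Icc 1 R, ∑ e ∈ Icc 1 R, ∑ k ∈ Icc 1 R, (k.totient : ℝ) *
          ((if k ∣ d then sieveWeight R d / d else 0) *
            (if k ∣ e then sieveWeight R e / e else 0)) :=
        sum_congr rfl fun d hd => sum_congr rfl fun e he => hterm d hd e he
    _ = ∑ k ∈ Icc 1 R, (k.totient : ℝ) *
          (∑ d ∈ Icc 1 R with k ∣ d, sieveWeight R d / d) ^ 2 := by
        simp_rw [sum_comm (s := Icc 1 R) (t := Icc 1 R)
          (f := fun e k => (Nat.totient k : ℝ) * _)]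
        rw [sum_comm]
        refine sum_congr rfl fun k _ => ?_
        rw [sq, sum_filter, sum_mul_sum, mul_sum]
        exact sum_congr rfl fun d _ => (mul_sum _ _ _).symm
    _ ≤ ∑ k ∈ Icc 1 R, squarefreeRecip k := by
        refine sum_le_sum fun k hk => ?_
        rw [sum_sieveWeight_div hk]
        by_cases hsf : Squarefree k
        · have hk0 : (0 : ℝ) < k := by have := (mem_Icc.1 hk).1; positivity
          have hμ : (ArithmeticFunction.moebius k : ℝ) ^ 2 = 1 := by
            exact_mod_cast ArithmeticFunction.moebius_sq_eq_one_of_squarefree hsf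
          have hφ : (k.totient : ℝ) ≤ k := by exact_mod_cast Nat.totient_le k
          rw [mul_pow, hμ, one_mul, squarefreeRecip, if_pos hsf]
          calc (k.totient : ℝ) * (k : ℝ)⁻¹ ^ 2 ≤ k * (k : ℝ)⁻¹ ^ 2 := by gcongr
            _ = (k : ℝ)⁻¹ := by field_simp
        · simp [squarefreeRecip, hsf]

open Finset in
theorem abs_card_filter_dvd_Ioc_sub_le (a h : ℕ) {m : ℕ} (hm : 0 < m) :
    |(#{n ∈ Ioc a (a + h) | m ∣ n} : ℝ) - h / m| ≤ 1 := by
  have hcard : #{n ∈ Ioc a (a + h) | m ∣ n} + a / m = (a + h) / m := by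
    rw [← Nat.Ioc_filter_dvd_card_eq_div a m, ← Nat.Ioc_filter_dvd_card_eq_div (a + h) m,
      ← card_union_of_disjoint, ← filter_union, union_comm,
      Ioc_union_Ioc_eq_Ioc (Nat.zero_le a) (Nat.le_add_right a h)]
    refine disjoint_filter_filter ?_
    rw [disjoint_left]
    intro n hn hn'
    simp only [mem_Ioc] at hn hn'
    omega
  have hm0 : (0 : ℝ) < m := by positivity
  have key : ∀ n : ℕ, ((n / m : ℕ) : ℝ) ≤ n / m ∧ (n : ℝ) / m < (n / m : ℕ) + 1 := fun n =>
    ⟨Nat.cast_div_le, by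
      rw [div_lt_iff₀ hm0]
      exact_mod_cast Nat.lt_mul_of_div_lt (Nat.lt_succ_self (n / m)) hm⟩
  obtain ⟨h1, h2⟩ := key a
  obtain ⟨h3, h4⟩ := key (a + h)
  have hc : (#{n ∈ Ioc a (a + h) | m ∣ n} : ℝ) + (a / m : ℕ) = ((a + h) / m : ℕ) := by
    exact_mod_cast hcard
  push_cast [add_div] at h3 h4
  rw [abs_le]
  constructor <;> linarith

open Finset in
/-- An upper bound of Brun–Titchmarsh type for the primes in a short interval. -/
theorem card_primes_Ioc_le (a h : ℕ) {R : ℕ} (hR : 1 ≤ R) (hRa : R ≤ a) :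
    (#{p ∈ Ioc a (a + h) | p.Prime} : ℝ) ≤ 2 * h / Real.log (R + 1 : ℕ) + R ^ 4 := by
  set S := squarefreeRecipSum R
  have hlog : 0 < Real.log (R + 1 : ℕ) := Real.log_pos (by exact_mod_cast (by omega : 1 < R + 1))
  have hlogS : Real.log (R + 1 : ℕ) ≤ 2 * S := log_le_two_mul_squarefreeRecipSum R
  have hS : 0 < S := by linarith
  have hprime : ∀ p ∈ {p ∈ Ioc a (a + h) | p.Prime},
      S ^ 2 = (∑ d ∈ Icc 1 R, if d ∣ p then sieveWeight R d else 0) ^ 2 := by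
    intro p hp
    rw [mem_filter, mem_Ioc] at hp
    have hfilter : {d ∈ Icc 1 R | d ∣ p} = {1} := by
      ext d
      simp only [mem_filter, mem_Icc, mem_singleton, Nat.dvd_prime hp.2]
      omega
    rw [← sum_filter, hfilter, sum_singleton, sieveWeight_one]
  have hsquare : ∑ n ∈ Ioc a (a + h), (∑ d ∈ Icc 1 R, if d ∣ n then sieveWeight R d else 0) ^ 2 =
      ∑ d ∈ Icc 1 R, ∑ e ∈ Icc 1 R,
        sieveWeight R d * sieveWeight R e * #{n ∈ Ioc a (a + h) | d.lcm e ∣ n} := by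
    simp_rw [sq, sum_mul_sum]
    rw [sum_comm]
    refine sum_congr rfl fun d _ => ?_
    rw [sum_comm]
    refine sum_congr rfl fun e _ => ?_
    rw [card_filter, Nat.cast_sum, mul_sum]
    refine sum_congr rfl fun n _ => ?_
    by_cases h1 : d ∣ n <;> by_cases h2 : e ∣ n <;> simp [h1, h2, Nat.lcm_dvd_iff]
  have hbound : ∀ d ∈ Icc 1 R, ∀ e ∈ Icc 1 R,
      sieveWeight R d * sieveWeight R e * #{n ∈ Ioc a (a + h) | d.lcm e ∣ n} ≤
        h * (sieveWeight R d * sieveWeight R e / (d.lcm e : ℝ)) +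
          |sieveWeight R d| * |sieveWeight R e| := by
    intro d hd e he
    have hlcm : 0 < d.lcm e := Nat.lcm_pos (mem_Icc.1 hd).1 (mem_Icc.1 he).1
    have herr := abs_card_filter_dvd_Ioc_sub_le a h hlcm
    have hle := (le_abs_self _).trans
      ((abs_mul (sieveWeight R d * sieveWeight R e) _).le.trans
        (mul_le_of_le_one_right (abs_nonneg _) herr))
    rw [abs_mul] at hle
    calc _ = h * (sieveWeight R d * sieveWeight R e / (d.lcm e : ℝ)) +
          sieveWeight R d * sieveWeight R e *
            (#{n ∈ Ioc a (a + h) | d.lcm e ∣ n} - h / (d.lcm e : ℝ)) := by ring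
      _ ≤ _ := by gcongr
  have hmain : (#{p ∈ Ioc a (a + h) | p.Prime} : ℝ) * S ^ 2 ≤ h * S + (R ^ 2 * S) ^ 2 := by
    calc (#{p ∈ Ioc a (a + h) | p.Prime} : ℝ) * S ^ 2
        = ∑ p ∈ Ioc a (a + h) with p.Prime,
            (∑ d ∈ Icc 1 R, if d ∣ p then sieveWeight R d else 0) ^ 2 := by
          rw [← sum_congr rfl hprime, sum_const, nsmul_eq_mul]
      _ ≤ ∑ n ∈ Ioc a (a + h), (∑ d ∈ Icc 1 R, if d ∣ n then sieveWeight R d else 0) ^ 2 :=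
          sum_le_sum_of_subset_of_nonneg (filter_subset _ _) fun _ _ _ => sq_nonneg _
      _ ≤ ∑ d ∈ Icc 1 R, ∑ e ∈ Icc 1 R,
            (h * (sieveWeight R d * sieveWeight R e / (d.lcm e : ℝ)) +
              |sieveWeight R d| * |sieveWeight R e|) := by
          rw [hsquare]
          exact sum_le_sum fun d hd => sum_le_sum fun e he => hbound d hd e he
      _ = h * (∑ d ∈ Icc 1 R, ∑ e ∈ Icc 1 R,
            sieveWeight R d * sieveWeight R e / (d.lcm e : ℝ)) +
              (∑ d ∈ Icc 1 R, |sieveWeight R d|) ^ 2 := by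
          simp_rw [sum_add_distrib, ← mul_sum, sq, sum_mul]
      _ ≤ h * S + (R ^ 2 * S) ^ 2 := by
          gcongr
          · exact sum_sieveWeight_mul_div_lcm_le R
          · exact sum_abs_sieveWeight_le R
  have hdiv : (#{p ∈ Ioc a (a + h) | p.Prime} : ℝ) ≤ h / S + R ^ 4 := by
    rw [← mul_le_mul_iff_left₀ (pow_pos hS 2)]
    refine hmain.trans (le_of_eq ?_)
    field_simp
  refine hdiv.trans (add_le_add_left ?_ _)
  rw [div_le_div_iff₀ hS hlog]
  have : (0 : ℝ) ≤ h := h.cast_nonneg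
  nlinarith

open Finset in
theorem sum_primes_inv_le_of_le_two_mul {z y : ℝ} (hz : 2 ≤ z) (hzy : z ≤ y) (hy : y ≤ 2 * z) :
    ∑ p ∈ Icc ⌈z⌉₊ ⌊y⌋₊ with p.Prime, (1 : ℝ) / p ≤
      60 * (Real.exp (-Real.sqrt (Real.log z)) + Real.log (y / z)) / Real.log z := by
  have hz0 : 0 < z := by linarith
  have hy0 : 0 < y := by linarith
  set L := Real.log z
  have hL0 : 0 < L := Real.log_pos (by linarith)
  have hexpL : Real.exp L = z := Real.exp_log hz0
  set R := ⌊Real.exp (L / 8)⌋₊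
  have hR : 1 ≤ R := Nat.le_floor (by simpa using (show 0 ≤ L / 8 by linarith))
  have hRle : (R : ℝ) ≤ Real.exp (L / 8) := Nat.floor_le (Real.exp_pos _).le
  have hRz : R < ⌈z⌉₊ := by
    rw [Nat.lt_ceil]
    refine hRle.trans_lt ?_
    rw [← hexpL]
    exact Real.exp_lt_exp.2 (by linarith)
  have hlogR : L / 8 ≤ Real.log (R + 1 : ℕ) := by
    rw [Real.le_log_iff_exp_le (by positivity)]
    push_cast
    exact (Nat.lt_floor_add_one _).le
  have hR4 : (R : ℝ) ^ 4 ≤ Real.exp (L / 2) := by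
    calc (R : ℝ) ^ 4 ≤ Real.exp (L / 8) ^ 4 := by gcongr
      _ = Real.exp (L / 2) := by rw [← Real.exp_nat_mul]; congr 1; push_cast; ring
  set a := ⌈z⌉₊ - 1
  set h := ⌊y⌋₊ - a with hh
  have hsub : Icc ⌈z⌉₊ ⌊y⌋₊ ⊆ Ioc a (a + h) := by
    intro n hn
    rw [mem_Icc] at hn
    rw [mem_Ioc]
    omega
  have hhle : (h : ℝ) ≤ y - z + 1 := by
    have h1 : (⌊y⌋₊ : ℝ) ≤ y := Nat.floor_le hy0.le
    have h2 : z ≤ a + 1 := by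
      have : a + 1 = ⌈z⌉₊ := by omega
      exact_mod_cast this ▸ Nat.le_ceil z
    rcases le_total a ⌊y⌋₊ with h3 | h3
    · rw [hh, Nat.cast_sub h3]; linarith
    · rw [hh, Nat.sub_eq_zero_of_le h3]; push_cast; linarith
  have hcard : (#{p ∈ Icc ⌈z⌉₊ ⌊y⌋₊ | p.Prime} : ℝ) ≤
      16 * (y - z + 1) / L + Real.exp (L / 2) := by
    calc (#{p ∈ Icc ⌈z⌉₊ ⌊y⌋₊ | p.Prime} : ℝ) ≤ #{p ∈ Ioc a (a + h) | p.Prime} := by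
          exact_mod_cast card_le_card (filter_subset_filter _ hsub)
      _ ≤ 2 * h / Real.log (R + 1 : ℕ) + R ^ 4 := card_primes_Ioc_le a h hR (by omega)
      _ ≤ 2 * (y - z + 1) / (L / 8) + Real.exp (L / 2) := by
          have : 0 ≤ y - z + 1 := by linarith
          gcongr
      _ = 16 * (y - z + 1) / L + Real.exp (L / 2) := by field_simp; ring
  have hsum : ∑ p ∈ Icc ⌈z⌉₊ ⌊y⌋₊ with p.Prime, (1 : ℝ) / p ≤
      #{p ∈ Icc ⌈z⌉₊ ⌊y⌋₊ | p.Prime} * (1 / z) := by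
    rw [← nsmul_eq_mul]
    refine sum_le_card_nsmul _ _ _ fun p hp => ?_
    exact one_div_le_one_div_of_le hz0 (Nat.ceil_le.1 (mem_Icc.1 (mem_filter.1 hp).1).1)
  set E := Real.exp (-Real.sqrt L) with hE
  have hE0 : 0 < E := Real.exp_pos _
  have hsqrt : Real.sqrt L ≤ L / 4 + 1 := by
    nlinarith [Real.sq_sqrt hL0.le, sq_nonneg (Real.sqrt L - 2)]
  have hlog : (y - z) / z ≤ 2 * Real.log (y / z) := by
    have h1 := Real.one_sub_inv_le_log_of_pos (div_pos hy0 hz0)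
    have h2 : (y - z) / (2 * z) ≤ 1 - (y / z)⁻¹ := by
      calc (y - z) / (2 * z) ≤ (y - z) / y := by gcongr
        _ = 1 - (y / z)⁻¹ := by field_simp
    have h3 : (y - z) / z = 2 * ((y - z) / (2 * z)) := by field_simp
    linarith
  have hquarter : Real.exp (-(L / 4)) ≤ Real.exp 1 * E := by
    rw [hE, ← Real.exp_add]
    exact Real.exp_le_exp.2 (by linarith)
  have hzinv : 1 / z ≤ Real.exp 1 * E := by
    refine le_trans ?_ hquarter
    rw [← hexpL, one_div, ← Real.exp_neg]
    exact Real.exp_le_exp.2 (by linarith)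
  have hhalf : L * (Real.exp (L / 2) / z) ≤ 4 * (Real.exp 1 * E) := by
    have h1 : L ≤ 4 * Real.exp (L / 4) := by linarith [Real.add_one_le_exp (L / 4)]
    calc L * (Real.exp (L / 2) / z) ≤ 4 * Real.exp (L / 4) * (Real.exp (L / 2) / z) := by gcongr
      _ = 4 * Real.exp (-(L / 4)) := by
          rw [show Real.exp (L / 2) / z = Real.exp (L / 2 - L) by rw [Real.exp_sub, hexpL], mul_assoc,
            ← Real.exp_add]
          ring_nf
      _ ≤ 4 * (Real.exp 1 * E) := by gcongr
  have hlog0 : 0 ≤ Real.log (y / z) := Real.log_nonneg ((one_le_div hz0).2 hzy)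
  calc _ ≤ (16 * (y - z + 1) / L + Real.exp (L / 2)) * (1 / z) :=
        hsum.trans (by gcongr)
    _ = (16 * ((y - z) / z) + 16 * (1 / z) + L * (Real.exp (L / 2) / z)) / L := by
        field_simp
    _ ≤ 60 * (E + Real.log (y / z)) / L := by
        gcongr
        nlinarith [Real.exp_one_lt_d9]

open Finset in
theorem sum_primes_inv_le_of_two_pow_mul (n : ℕ) {z : ℝ} (hz : 2 ≤ z) :
    ∑ p ∈ Icc ⌈z⌉₊ ⌊2 ^ n * z⌋₊ with p.Prime, (1 : ℝ) / p ≤ (n + 1) * 120 / Real.log z := by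
  have hdouble : ∀ x : ℝ, 2 ≤ x →
      ∑ p ∈ Icc ⌈x⌉₊ ⌊2 * x⌋₊ with p.Prime, (1 : ℝ) / p ≤ 120 / Real.log x := by
    intro x hx
    have hlogx : 0 < Real.log x := Real.log_pos (by linarith)
    refine (sum_primes_inv_le_of_le_two_mul hx (by linarith) le_rfl).trans ?_
    have h1 : Real.exp (-Real.sqrt (Real.log x)) ≤ 1 :=
      Real.exp_le_one_iff.2 (neg_nonpos.2 (Real.sqrt_nonneg _))
    rw [mul_div_cancel_right₀ _ (by linarith : x ≠ 0)]
    gcongr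
    linarith [Real.log_two_lt_d9]
  have hlogz : 0 < Real.log z := Real.log_pos (by linarith)
  induction n with
  | zero =>
    refine le_trans (sum_le_sum_of_subset_of_nonneg ?_ fun _ _ _ => by positivity)
      ((hdouble z hz).trans_eq (by simp))
    exact filter_subset_filter _ (Icc_subset_Icc_right (Nat.floor_mono (by linarith)))
  | succ n ih =>
    have hpow : (1 : ℝ) ≤ 2 ^ n := one_le_pow₀ one_le_two
    have hzle : z ≤ 2 ^ n * z := le_mul_of_one_le_left (by linarith) hpow
    have hsub : {p ∈ Icc ⌈z⌉₊ ⌊2 ^ (n + 1) * z⌋₊ | p.Prime} ⊆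
        {p ∈ Icc ⌈z⌉₊ ⌊2 ^ n * z⌋₊ | p.Prime} ∪
          {p ∈ Icc ⌈2 ^ n * z⌉₊ ⌊2 * (2 ^ n * z)⌋₊ | p.Prime} := by
      intro p hp
      rw [← mul_assoc, ← pow_succ']
      simp only [mem_union, mem_filter, mem_Icc] at hp ⊢
      rcases le_total (p : ℝ) (2 ^ n * z) with h | h
      · exact Or.inl ⟨⟨hp.1.1, Nat.le_floor h⟩, hp.2⟩
      · exact Or.inr ⟨⟨Nat.ceil_le.2 h, hp.1.2⟩, hp.2⟩
    calc _ ≤ ∑ p ∈ {p ∈ Icc ⌈z⌉₊ ⌊2 ^ n * z⌋₊ | p.Prime} ∪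
          {p ∈ Icc ⌈2 ^ n * z⌉₊ ⌊2 * (2 ^ n * z)⌋₊ | p.Prime}, (1 : ℝ) / p :=
          sum_le_sum_of_subset_of_nonneg hsub fun _ _ _ => by positivity
      _ ≤ ∑ p ∈ Icc ⌈z⌉₊ ⌊2 ^ n * z⌋₊ with p.Prime, (1 : ℝ) / p +
          ∑ p ∈ Icc ⌈2 ^ n * z⌉₊ ⌊2 * (2 ^ n * z)⌋₊ with p.Prime, (1 : ℝ) / p :=
          (le_add_of_nonneg_right (sum_nonneg fun _ _ => by positivity)).trans_eq
            sum_union_inter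
      _ ≤ (n + 1) * 120 / Real.log z + 120 / Real.log z := by
          refine add_le_add ih ((hdouble _ (hz.trans hzle)).trans ?_)
          gcongr
      _ = _ := by push_cast; ring

theorem stmt6 : ∃ C c : ℝ, 0 < C ∧ 0 < c ∧ ∀ z y : ℝ, 2 ≤ z → z ≤ y →
    ∑ p ∈ (Finset.Icc ⌈z⌉₊ ⌊y⌋₊).filter Nat.Prime, (1 : ℝ) / p ≤
      C * (Real.exp (-c * Real.sqrt (Real.log z)) + Real.log (y / z)) / Real.log z := by
  refine ⟨600, 1, by norm_num, one_pos, fun z y hz hzy => ?_⟩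
  have hz0 : 0 < z := by linarith
  have hlogz : 0 < Real.log z := Real.log_pos (by linarith)
  have hlog0 : 0 ≤ Real.log (y / z) := Real.log_nonneg ((one_le_div hz0).2 hzy)
  rw [neg_one_mul]
  have hE0 : 0 < Real.exp (-Real.sqrt (Real.log z)) := Real.exp_pos _
  rcases le_total y (2 * z) with hy | hy
  · refine (sum_primes_inv_le_of_le_two_mul hz hzy hy).trans ?_
    gcongr
    norm_num
  · have hyz : 2 ≤ y / z := (le_div_iff₀ hz0).2 hy
    have hlog2 : Real.log 2 ≤ Real.log (y / z) := Real.log_le_log two_pos hyz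
    have hlog2' := Real.log_two_gt_d9
    set n := ⌈Real.log (y / z) / Real.log 2⌉₊
    have hn1 : Real.log (y / z) ≤ n * Real.log 2 :=
      (div_le_iff₀ (by linarith)).1 (Nat.le_ceil _)
    have hn2 : (n : ℝ) < Real.log (y / z) / Real.log 2 + 1 := Nat.ceil_lt_add_one (by positivity)
    have hn3 : Real.log (y / z) / Real.log 2 ≤ Real.log (y / z) * (3 / 2) := by
      rw [div_le_iff₀ (by linarith)]
      nlinarith
    have hypow : y ≤ 2 ^ n * z := by
      rw [← div_le_iff₀ hz0, ← Real.log_le_log_iff (by linarith) (by positivity), Real.log_pow]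
      exact hn1
    refine le_trans (Finset.sum_le_sum_of_subset_of_nonneg (Finset.filter_subset_filter _
      (Finset.Icc_subset_Icc_right (Nat.floor_mono hypow))) fun _ _ _ => by positivity)
      ((sum_primes_inv_le_of_two_pow_mul n hz).trans ?_)
    refine div_le_div_of_nonneg_right ?_ hlogz.le
    nlinarith
end

section
/- There is an absolute constant C > 0 such that for all sufficiently large real x, with L = (log x)^{10}, D = exp((log log x)^3), R = x^{1/(3 log log x)}, the set E of natural numbers n ≤ x satisfying at least one of: (i) n ≤ x/L; (ii) all prime factors of n are ≤ R; (iii) d² divides n for some d > L; (iv) n is divisible by some d > D all of whose prime factors are ≤ L; (v) n = d·p₂·p₁ with all prime factors of d at most L and p₁, p₂ primes with R/L ≤ p₂ ≤ p₁ ≤ p₂·L; (vi) n = d·p₃·p₂·p₁ with p₁, p₂, p₃ primes satisfying R/L² ≤ p₃ ≤ p₂ ≤ p₁ ≤ p₃·L², has cardinality at most C · x · (log log x)^5 / (log x)². -/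
open scoped BigOperators

/-- The scale `L = (log x)^10`. -/
noncomputable def Lx (x : ℝ) : ℝ := (Real.log x) ^ 10

/-- The scale `D = exp((log log x)^3)`. -/
noncomputable def Dx (x : ℝ) : ℝ := Real.exp ((Real.log (Real.log x)) ^ 3)

/-- The scale `R = x^(1/(3 log log x))`. -/
noncomputable def Rx (x : ℝ) : ℝ := x ^ (1 / (3 * Real.log (Real.log x)))

/-- Membership in the exceptional set `E`: `n` satisfies at least one of conditions
(i)--(vi). -/
def inE (x : ℝ) (n : ℕ) : Prop :=
  ((n : ℝ) ≤ x / Lx x) ∨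
  (∀ p : ℕ, p.Prime → p ∣ n → (p : ℝ) ≤ Rx x) ∨
  (∃ d : ℕ, Lx x < (d : ℝ) ∧ d ^ 2 ∣ n) ∨
  (∃ d : ℕ, Dx x < (d : ℝ) ∧ (∀ p : ℕ, p.Prime → p ∣ d → (p : ℝ) ≤ Lx x) ∧ d ∣ n) ∨
  (∃ d p₁ p₂ : ℕ, n = d * p₂ * p₁ ∧ (∀ p : ℕ, p.Prime → p ∣ d → (p : ℝ) ≤ Lx x) ∧
    p₁.Prime ∧ p₂.Prime ∧ Rx x / Lx x ≤ (p₂ : ℝ) ∧ p₂ ≤ p₁ ∧ (p₁ : ℝ) ≤ (p₂ : ℝ) * Lx x) ∨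
  (∃ d p₁ p₂ p₃ : ℕ, n = d * p₃ * p₂ * p₁ ∧ p₁.Prime ∧ p₂.Prime ∧ p₃.Prime ∧
    Rx x / (Lx x) ^ 2 ≤ (p₃ : ℝ) ∧ p₃ ≤ p₂ ∧ p₂ ≤ p₁ ∧ (p₁ : ℝ) ≤ (p₃ : ℝ) * (Lx x) ^ 2)

open Filter

/-- Chebyshev's bound over a dyadic block: `∑ log p / p ≤ 4 log 2` for primes in `[A, 2A)`. -/
lemma sum_log_div_dyadic_le {A : ℝ} (hA : 0 < A) (T : Finset ℕ)
    (hT : ∀ p ∈ T, p.Prime ∧ A ≤ p ∧ (p : ℝ) < 2 * A) :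
    ∑ p ∈ T, Real.log p / p ≤ 4 * Real.log 2 := by
  have h1 : ∑ p ∈ T, Real.log p / p ≤ ∑ p ∈ T, Real.log p / A := by
    refine Finset.sum_le_sum fun p hp => ?_
    obtain ⟨hp, h, -⟩ := hT p hp
    exact div_le_div_of_nonneg_left (Real.log_natCast_nonneg p) hA h
  have h2 : ∑ p ∈ T, Real.log p ≤ Chebyshev.theta (2 * A) := by
    rw [Chebyshev.theta]
    refine Finset.sum_le_sum_of_subset_of_nonneg (fun p hp => ?_)
      fun p _ _ => Real.log_natCast_nonneg p
    obtain ⟨hp, -, h⟩ := hT p hp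
    simp only [Finset.mem_filter, Finset.mem_Ioc]
    exact ⟨⟨hp.pos, Nat.le_floor h.le⟩, hp⟩
  have h3 := Chebyshev.theta_le_log4_mul_x (x := 2 * A) (by positivity)
  have h4 : Real.log 4 = 2 * Real.log 2 := by
    rw [show (4 : ℝ) = 2 ^ 2 by norm_num, Real.log_pow]; norm_num
  rw [← Finset.sum_div] at h1
  refine h1.trans ?_
  rw [div_le_iff₀ hA]
  rw [h4] at h3
  linarith

lemma sum_log_div_pow_two_le {A : ℝ} (hA : 0 < A) (J : ℕ) (T : Finset ℕ)
    (hT : ∀ p ∈ T, p.Prime ∧ A ≤ p ∧ (p : ℝ) < 2 ^ J * A) :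
    ∑ p ∈ T, Real.log p / p ≤ 4 * Real.log 2 * J := by
  induction J generalizing T with
  | zero =>
    have : T = ∅ := by
      refine Finset.eq_empty_of_forall_notMem fun p hp => ?_
      obtain ⟨-, h, h'⟩ := hT p hp
      rw [pow_zero, one_mul] at h'
      linarith
    simp [this]
  | succ J ih =>
    rw [← Finset.sum_filter_add_sum_filter_not T (fun p : ℕ => (p : ℝ) < 2 ^ J * A)]
    have h1 := ih (T.filter fun p : ℕ => (p : ℝ) < 2 ^ J * A) fun p hp => by
      rw [Finset.mem_filter] at hp
      exact ⟨(hT p hp.1).1, (hT p hp.1).2.1, hp.2⟩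
    have h2 := sum_log_div_dyadic_le (A := 2 ^ J * A) (by positivity)
      (T.filter fun p : ℕ => ¬ (p : ℝ) < 2 ^ J * A) fun p hp => by
        rw [Finset.mem_filter, not_lt] at hp
        refine ⟨(hT p hp.1).1, hp.2, (hT p hp.1).2.2.trans_eq (by ring)⟩
    push_cast
    linarith

/-- Mertens-type upper bound for `∑ log p / p` over the primes in `[A, B]`. -/
lemma sum_log_div_prime_le {A B : ℝ} (hA : 0 < A) (hAB : A ≤ B) (T : Finset ℕ)
    (hT : ∀ p ∈ T, p.Prime ∧ A ≤ p ∧ (p : ℝ) ≤ B) :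
    ∑ p ∈ T, Real.log p / p ≤ 4 * Real.log (B / A) + 4 := by
  have hl2 : 0 < Real.log 2 := Real.log_pos one_lt_two
  have hBA : 1 ≤ B / A := (one_le_div hA).2 hAB
  have hlog : 0 ≤ Real.log (B / A) := Real.log_nonneg hBA
  set J := ⌊Real.log (B / A) / Real.log 2⌋₊ + 1 with hJ
  have hJ1 : Real.log (B / A) / Real.log 2 < J := by
    rw [hJ]; push_cast; exact Nat.lt_floor_add_one _
  have hJ2 : (J : ℝ) ≤ Real.log (B / A) / Real.log 2 + 1 := by
    rw [hJ]; push_cast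
    gcongr
    exact Nat.floor_le (by positivity)
  have hB : B < 2 ^ J * A := by
    rw [← div_lt_iff₀ hA, ← Real.log_lt_log_iff (by linarith) (by positivity), Real.log_pow]
    rwa [div_lt_iff₀ hl2] at hJ1
  refine (sum_log_div_pow_two_le hA J T fun p hp =>
    ⟨(hT p hp).1, (hT p hp).2.1, (hT p hp).2.2.trans_lt hB⟩).trans ?_
  calc 4 * Real.log 2 * J ≤ 4 * Real.log 2 * (Real.log (B / A) / Real.log 2 + 1) := by gcongr
    _ = 4 * Real.log (B / A) + 4 * Real.log 2 := by field_simp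
    _ ≤ _ := by linarith [Real.log_two_lt_d9]

lemma sum_inv_prime_le {A B : ℝ} (hA : 1 < A) (hAB : A ≤ B) (T : Finset ℕ)
    (hT : ∀ p ∈ T, p.Prime ∧ A ≤ p ∧ (p : ℝ) ≤ B) :
    ∑ p ∈ T, (p : ℝ)⁻¹ ≤ (4 * Real.log (B / A) + 4) / Real.log A := by
  have hl : 0 < Real.log A := Real.log_pos hA
  rw [le_div_iff₀ hl, Finset.sum_mul]
  refine (Finset.sum_le_sum fun p hp => ?_).trans (sum_log_div_prime_le (by linarith) hAB T hT)
  obtain ⟨-, h, -⟩ := hT p hp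
  rw [div_eq_inv_mul]
  gcongr

lemma sum_inv_prime_le_exp_two_pow (J : ℕ) (T : Finset ℕ)
    (hT : ∀ p ∈ T, p.Prime ∧ (p : ℝ) ≤ Real.exp (2 ^ J)) :
    ∑ p ∈ T, (p : ℝ)⁻¹ ≤ 8 * J + 1 := by
  induction J generalizing T with
  | zero =>
    have : T ⊆ {2} := fun p hp => by
      obtain ⟨h, h'⟩ := hT p hp
      have h3 : (p : ℝ) < 3 := by
        refine h'.trans_lt ?_
        rw [pow_zero]
        linarith [Real.exp_one_lt_d9]
      have := h.two_le
      have : p < 3 := by exact_mod_cast h3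
      simp; omega
    refine (Finset.sum_le_sum_of_subset_of_nonneg this fun _ _ _ => by positivity).trans ?_
    norm_num
  | succ J ih =>
    rw [← Finset.sum_filter_add_sum_filter_not T (fun p : ℕ => (p : ℝ) ≤ Real.exp (2 ^ J))]
    have h1 := ih (T.filter fun p : ℕ => (p : ℝ) ≤ Real.exp (2 ^ J)) fun p hp => by
      rw [Finset.mem_filter] at hp
      exact ⟨(hT p hp.1).1, hp.2⟩
    have h2 := sum_inv_prime_le (A := Real.exp (2 ^ J)) (B := Real.exp (2 ^ (J + 1)))
      (by rw [Real.one_lt_exp_iff]; positivity)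
      (Real.exp_le_exp.2 (pow_le_pow_right₀ one_le_two (Nat.le_succ _)))
      (T.filter fun p : ℕ => ¬ (p : ℝ) ≤ Real.exp (2 ^ J)) fun p hp => by
        rw [Finset.mem_filter, not_le] at hp
        exact ⟨(hT p hp.1).1, hp.2.le, (hT p hp.1).2⟩
    rw [← Real.exp_sub, Real.log_exp, Real.log_exp] at h2
    have h3 : (4 * ((2 : ℝ) ^ (J + 1) - 2 ^ J) + 4) / 2 ^ J ≤ 8 := by
      rw [div_le_iff₀ (by positivity)]
      have : (1 : ℝ) ≤ 2 ^ J := one_le_pow₀ one_le_two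
      rw [pow_succ]; linarith
    push_cast
    linarith

/-- Mertens-type upper bound for the sum of the reciprocals of the primes up to `y`. -/
lemma sum_inv_prime_le_log_log {y : ℝ} (hy : 1 ≤ Real.log y) (T : Finset ℕ)
    (hT : ∀ p ∈ T, p.Prime ∧ (p : ℝ) ≤ y) :
    ∑ p ∈ T, (p : ℝ)⁻¹ ≤ 12 * Real.log (Real.log y) + 9 := by
  have hl2 := Real.log_two_gt_d9
  have hll : 0 ≤ Real.log (Real.log y) := Real.log_nonneg hy
  set J := ⌈Real.log (Real.log y) / Real.log 2⌉₊ with hJ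
  have hJ1 : Real.log (Real.log y) / Real.log 2 ≤ J := Nat.le_ceil _
  have hJ2 : (J : ℝ) < Real.log (Real.log y) / Real.log 2 + 1 :=
    Nat.ceil_lt_add_one (by positivity)
  have hB : y ≤ Real.exp (2 ^ J) := by
    refine (Real.le_exp_log y).trans (Real.exp_le_exp.2 ?_)
    rw [← Real.log_le_log_iff (by linarith) (by positivity), Real.log_pow]
    rwa [div_le_iff₀ (by linarith)] at hJ1
  refine (sum_inv_prime_le_exp_two_pow J T fun p hp =>
    ⟨(hT p hp).1, (hT p hp).2.trans hB⟩).trans ?_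
  have : Real.log (Real.log y) / Real.log 2 ≤ 3 / 2 * Real.log (Real.log y) := by
    rw [div_le_iff₀ (by linarith)]
    nlinarith
  linarith

/-- The map `n ↦ n ^ (-s)` as a monoid homomorphism. -/
noncomputable def natRpowNegHom (s : ℝ) : ℕ →* ℝ where
  toFun n := (n : ℝ) ^ (-s)
  map_one' := by simp
  map_mul' m n := by
    push_cast
    exact Real.mul_rpow (Nat.cast_nonneg m) (Nat.cast_nonneg n)

lemma sum_smooth_rpow_neg_le_exp {s y : ℝ} (hs : 1 / 2 ≤ s) (T : Finset ℕ)
    (hT : ∀ n ∈ T, ∀ p : ℕ, p.Prime → p ∣ n → (p : ℝ) ≤ y) :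
    ∑ n ∈ T, (n : ℝ) ^ (-s) ≤
      Real.exp (4 * ∑ p ∈ Finset.range (⌊y⌋₊ + 1) with p.Prime, (p : ℝ) ^ (-s)) := by
  have hp34 : ∀ p : ℕ, p.Prime → (p : ℝ) ^ (-s) ≤ 3 / 4 := by
    intro p hp
    have h2 : (2 : ℝ) ≤ p := by exact_mod_cast hp.two_le
    calc (p : ℝ) ^ (-s) ≤ (p : ℝ) ^ (-(1 / 2) : ℝ) :=
          Real.rpow_le_rpow_of_exponent_le (by linarith) (by linarith)
      _ ≤ (2 : ℝ) ^ (-(1 / 2) : ℝ) :=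
          Real.rpow_le_rpow_of_nonpos (by norm_num) h2 (by norm_num)
      _ = (√2)⁻¹ := by
          rw [Real.rpow_neg (by norm_num), Real.sqrt_eq_rpow]
      _ ≤ 3 / 4 := by
          rw [show (3 / 4 : ℝ) = (4 / 3)⁻¹ by norm_num]
          exact inv_anti₀ (by norm_num) (Real.le_sqrt_of_sq_le (by norm_num))
  obtain ⟨-, hhas⟩ :=
    EulerProduct.summable_and_hasSum_factoredNumbers_prod_filter_prime_geometric (f := natRpowNegHom s) (fun {p} hp => by
      change ‖(p : ℝ) ^ (-s)‖ < 1
      rw [Real.norm_of_nonneg (by positivity)]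
      linarith [hp34 p hp]) (Finset.range (⌊y⌋₊ + 1))
  have hmem : ∀ n ∈ T, n ∈ Nat.factoredNumbers (Finset.range (⌊y⌋₊ + 1)) := by
    intro n hn
    rw [Nat.mem_factoredNumbers']
    intro p hp hpn
    rw [Finset.mem_range, Nat.lt_succ_iff]
    exact Nat.le_floor (hT n hn p hp hpn)
  have h1 : ∑ n ∈ T, (n : ℝ) ^ (-s) ≤
      ∏ p ∈ Finset.range (⌊y⌋₊ + 1) with p.Prime, (1 - natRpowNegHom s p)⁻¹ := by
    have := sum_le_hasSum
      (T.attach.map ⟨fun n => (⟨n.1, hmem n.1 n.2⟩ :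
        Nat.factoredNumbers (Finset.range (⌊y⌋₊ + 1))), fun _ _ h => by
          rw [Subtype.mk.injEq] at h
          exact Subtype.ext h⟩) (fun i _ => by
        change (0 : ℝ) ≤ ((i : ℕ) : ℝ) ^ (-s)
        positivity) hhas
    rw [Finset.sum_map] at this
    rw [← Finset.sum_attach]
    exact this
  refine h1.trans ?_
  rw [Finset.mul_sum, Real.exp_sum]
  refine Finset.prod_le_prod (fun p hp => ?_) fun p hp => ?_
  all_goals
    have hb := hp34 p (Finset.mem_filter.1 hp).2
    have h0 : (0 : ℝ) ≤ (p : ℝ) ^ (-s) := by positivity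
  · change 0 ≤ (1 - (p : ℝ) ^ (-s))⁻¹
    exact inv_nonneg.2 (by linarith)
  · change (1 - (p : ℝ) ^ (-s))⁻¹ ≤ _
    set t := (p : ℝ) ^ (-s)
    refine le_trans ?_ (Real.add_one_le_exp _)
    rw [inv_le_iff_one_le_mul₀ (by linarith)]
    nlinarith

/-- **Rankin's method**: the sum of `n ^ (-(1 - c / log y))` over `y`-smooth numbers is at most a
power of `log y`, whose exponent does not depend on `c`. -/
lemma exists_sum_smooth_rpow_le {c : ℝ} (hc : 0 ≤ c) :
    ∃ C : ℝ, 0 < C ∧ ∀ y : ℝ, 1 ≤ y → 1 ≤ Real.log y → 2 * c ≤ Real.log y → ∀ T : Finset ℕ,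
      (∀ n ∈ T, ∀ p : ℕ, p.Prime → p ∣ n → (p : ℝ) ≤ y) →
      ∑ n ∈ T, (n : ℝ) ^ (-(1 - c / Real.log y)) ≤ C * Real.log y ^ 48 := by
  refine ⟨Real.exp (36 + 32 * c * Real.exp c), Real.exp_pos _, fun y hy1 hy hcy T hT => ?_⟩
  have hy0 : 0 < Real.log y := by linarith
  have hs : 1 / 2 ≤ 1 - c / Real.log y := by
    have : c / Real.log y ≤ 1 / 2 := by rw [div_le_iff₀ hy0]; linarith
    linarith
  refine (sum_smooth_rpow_neg_le_exp hs T hT).trans ?_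
  set P := (Finset.range (⌊y⌋₊ + 1)).filter Nat.Prime with hP
  have hPm : ∀ p ∈ P, p.Prime ∧ (p : ℝ) ≤ y := by
    intro p hp
    rw [hP, Finset.mem_filter, Finset.mem_range, Nat.lt_succ_iff,
      Nat.le_floor_iff (by linarith)] at hp
    exact ⟨hp.2, hp.1⟩
  have h1 : ∀ p ∈ P, (p : ℝ) ^ (-(1 - c / Real.log y)) ≤
      (p : ℝ)⁻¹ + c * Real.exp c / Real.log y * (Real.log p / p) := by
    intro p hp
    obtain ⟨hp, hpy⟩ := hPm p hp
    have hp0 : (0 : ℝ) < p := by exact_mod_cast hp.pos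
    have hlp : 0 ≤ Real.log p := Real.log_natCast_nonneg p
    have hlpy : Real.log p ≤ Real.log y := Real.log_le_log hp0 hpy
    set t := c / Real.log y * Real.log p with ht
    have ht0 : 0 ≤ t := by positivity
    have htc : t ≤ c := by
      rw [ht, div_mul_eq_mul_div, div_le_iff₀ hy0]; gcongr
    have hexp : Real.exp t ≤ 1 + t * Real.exp c := by
      have h := Real.add_one_le_exp (-t)
      have h2 : Real.exp t * Real.exp (-t) = 1 := by rw [← Real.exp_add]; simp
      have h3 : Real.exp t ≤ Real.exp c := Real.exp_le_exp.2 htc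
      nlinarith [Real.exp_pos t]
    have : (p : ℝ) ^ (-(1 - c / Real.log y)) = (p : ℝ)⁻¹ * Real.exp t := by
      rw [neg_sub, sub_eq_neg_add, Real.rpow_add hp0, Real.rpow_neg_one,
        Real.rpow_def_of_pos hp0, ht, mul_comm (Real.log p)]
    rw [this]
    calc (p : ℝ)⁻¹ * Real.exp t ≤ (p : ℝ)⁻¹ * (1 + t * Real.exp c) := by gcongr
      _ = _ := by rw [ht]; field_simp
  have h2 := Finset.sum_le_sum h1
  rw [Finset.sum_add_distrib, ← Finset.mul_sum] at h2
  have h3 := sum_inv_prime_le_log_log hy P hPm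
  have h4 := sum_log_div_prime_le (A := 1) one_pos hy1 P fun p hp =>
    ⟨(hPm p hp).1, by exact_mod_cast (hPm p hp).1.one_le, (hPm p hp).2⟩
  have h5 : c * Real.exp c / Real.log y * (∑ p ∈ P, Real.log p / p) ≤ 8 * c * Real.exp c := by
    rw [div_mul_eq_mul_div, div_le_iff₀ hy0]
    rw [div_one] at h4
    have : 0 ≤ c * Real.exp c := by positivity
    nlinarith
  calc _ ≤ Real.exp ((36 + 32 * c * Real.exp c) + 48 * Real.log (Real.log y)) :=
        Real.exp_le_exp.2 (by linarith)
    _ = _ := by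
      have := Real.exp_nat_mul (Real.log (Real.log y)) 48
      rw [Real.exp_log hy0, Nat.cast_ofNat] at this
      rw [Real.exp_add, this]

/-- If every `n ∈ S` up to `x` is divisible by some `f t`, `t ∈ T`, then `S` has at most
`∑ x / f t` elements up to `x`. -/
lemma ncard_le_sum_div {ι : Type*} {x : ℝ} (hx : 0 ≤ x) (T : Finset ι) (f : ι → ℕ)
    (S : Set ℕ) (hS : ∀ n ∈ S, 1 ≤ n ∧ (n : ℝ) ≤ x ∧ ∃ t ∈ T, f t ∣ n) :
    (S.ncard : ℝ) ≤ ∑ t ∈ T, x / f t := by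
  have hsub : S ⊆ ↑(T.biUnion fun t => (Finset.Ioc 0 ⌊x⌋₊).filter (f t ∣ ·)) := by
    intro n hn
    obtain ⟨h1, h2, t, ht, h3⟩ := hS n hn
    simp only [Finset.coe_biUnion, Set.mem_iUnion, Finset.coe_filter, Set.mem_ofPred_eq,
      Finset.mem_Ioc, Finset.mem_coe]
    exact ⟨t, ht, ⟨h1, Nat.le_floor h2⟩, h3⟩
  have h1 := (Set.ncard_le_ncard hsub (Finset.finite_toSet _))
  rw [Set.ncard_coe_finset] at h1
  have h2 := h1.trans Finset.card_biUnion_le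
  calc (S.ncard : ℝ) ≤ ((∑ t ∈ T, ((Finset.Ioc 0 ⌊x⌋₊).filter (f t ∣ ·)).card : ℕ) : ℝ) := by
        exact_mod_cast h2
    _ ≤ _ := by
        push_cast
        refine Finset.sum_le_sum fun t _ => ?_
        rw [Nat.Ioc_filter_dvd_card_eq_div]
        refine Nat.cast_div_le.trans ?_
        gcongr
        exact Nat.floor_le hx

/-- If every `n ∈ S` up to `x` is a prime multiple of some `f t`, `t ∈ T`, then `S` has at most
`∑ π (x / f t)` elements up to `x`. -/
lemma ncard_le_sum_primeCounting {ι : Type*} {x : ℝ} (T : Finset ι) (f : ι → ℕ)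
    (S : Set ℕ) (hS : ∀ n ∈ S, 1 ≤ n ∧ (n : ℝ) ≤ x ∧ ∃ t ∈ T, ∃ p : ℕ, p.Prime ∧ n = f t * p) :
    (S.ncard : ℝ) ≤ ∑ t ∈ T, (Nat.primeCounting ⌊x / f t⌋₊ : ℝ) := by
  have hsub : S ⊆ ↑(T.biUnion fun t => (Nat.primesLE ⌊x / f t⌋₊).image (f t * ·)) := by
    intro n hn
    obtain ⟨h1, h2, t, ht, p, hp, rfl⟩ := hS n hn
    simp only [Finset.coe_biUnion, Set.mem_iUnion, Finset.coe_image, Set.mem_image,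
      Finset.mem_coe, Nat.mem_primesLE]
    refine ⟨t, ht, p, ⟨Nat.le_floor ?_, hp⟩, rfl⟩
    have : (0 : ℝ) < f t := by exact_mod_cast Nat.pos_of_mul_pos_right h1
    rw [le_div_iff₀ this, mul_comm]
    exact_mod_cast h2
  have h1 := (Set.ncard_le_ncard hsub (Finset.finite_toSet _))
  rw [Set.ncard_coe_finset] at h1
  have h2 := h1.trans Finset.card_biUnion_le
  calc (S.ncard : ℝ) ≤
        ((∑ t ∈ T, ((Nat.primesLE ⌊x / f t⌋₊).image (f t * ·)).card : ℕ) : ℝ) := by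
        exact_mod_cast h2
    _ ≤ _ := by
        push_cast
        refine Finset.sum_le_sum fun t _ => ?_
        rw [← Nat.primesLE_card_eq_primeCounting]
        exact_mod_cast Finset.card_image_le

/-- The natural numbers `1 ≤ n ≤ x` satisfying `P x` number `O(x (log log x)^5 / (log x)^2)`. -/
def IsSparse (P : ℝ → ℕ → Prop) : Prop :=
  ∃ C : ℝ, 0 < C ∧ ∀ᶠ x in atTop, ({n : ℕ | 1 ≤ n ∧ (n : ℝ) ≤ x ∧ P x n}.ncard : ℝ) ≤
    C * x * (Real.log (Real.log x)) ^ 5 / (Real.log x) ^ 2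

lemma finite_setOf_le_and (x : ℝ) (P : ℕ → Prop) :
    {n : ℕ | 1 ≤ n ∧ (n : ℝ) ≤ x ∧ P n}.Finite :=
  (Set.finite_Iic ⌊x⌋₊).subset fun _ hn => Nat.le_floor hn.2.1

lemma IsSparse.or {P Q : ℝ → ℕ → Prop} (hP : IsSparse P) (hQ : IsSparse Q) :
    IsSparse fun x n => P x n ∨ Q x n := by
  obtain ⟨C, hC, hP⟩ := hP
  obtain ⟨C', hC', hQ⟩ := hQ
  refine ⟨C + C', by positivity, ?_⟩
  filter_upwards [hP, hQ] with x h1 h2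
  have hsub : {n : ℕ | 1 ≤ n ∧ (n : ℝ) ≤ x ∧ (P x n ∨ Q x n)} =
      {n : ℕ | 1 ≤ n ∧ (n : ℝ) ≤ x ∧ P x n} ∪ {n : ℕ | 1 ≤ n ∧ (n : ℝ) ≤ x ∧ Q x n} := by
    ext n
    simp only [Set.mem_ofPred_eq, Set.mem_union]
    tauto
  rw [hsub]
  calc _ ≤ (({n : ℕ | 1 ≤ n ∧ (n : ℝ) ≤ x ∧ P x n}.ncard +
        {n : ℕ | 1 ≤ n ∧ (n : ℝ) ≤ x ∧ Q x n}.ncard : ℕ) : ℝ) := by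
        exact_mod_cast Set.ncard_union_le _ _
    _ ≤ _ := by
        push_cast
        refine (add_le_add h1 h2).trans_eq (by ring)

lemma IsSparse.mono {P Q : ℝ → ℕ → Prop} (hP : IsSparse P)
    (h : ∀ᶠ x in atTop, ∀ n : ℕ, 1 ≤ n → (n : ℝ) ≤ x → Q x n → P x n) : IsSparse Q := by
  obtain ⟨C, hC, hP⟩ := hP
  refine ⟨C, hC, ?_⟩
  filter_upwards [hP, h] with x h1 h2
  refine le_trans ?_ h1
  have hsub : {n : ℕ | 1 ≤ n ∧ (n : ℝ) ≤ x ∧ Q x n} ⊆ {n : ℕ | 1 ≤ n ∧ (n : ℝ) ≤ x ∧ P x n} :=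
    fun n hn => ⟨hn.1, hn.2.1, h2 n hn.1 hn.2.1 hn.2.2⟩
  exact_mod_cast Set.ncard_le_ncard hsub (finite_setOf_le_and x (P x))

lemma tendsto_log_log_atTop : Tendsto (fun x => Real.log (Real.log x)) atTop atTop :=
  Real.tendsto_log_atTop.comp Real.tendsto_log_atTop

lemma eventually_exp_log_log :
    ∀ᶠ x : ℝ in atTop, Real.log x = Real.exp (Real.log (Real.log x)) := by
  filter_upwards [Real.tendsto_log_atTop.eventually_gt_atTop 0] with x hx
  rw [Real.exp_log hx]

lemma eventually_mul_pow_log_log_le (a : ℝ) (k : ℕ) :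
    ∀ᶠ x : ℝ in atTop, a * Real.log (Real.log x) ^ k ≤ Real.log x := by
  have h := ((Real.tendsto_exp_div_pow_atTop k).comp tendsto_log_log_atTop).eventually_ge_atTop a
  filter_upwards [h, eventually_exp_log_log, tendsto_log_log_atTop.eventually_gt_atTop 0]
    with x h1 h2 h3
  rw [Function.comp_apply, ← h2, le_div_iff₀ (by positivity)] at h1
  exact h1

lemma log_Lx (x : ℝ) : Real.log (Lx x) = 10 * Real.log (Real.log x) := by
  rw [Lx, Real.log_pow]; norm_num

lemma log_Rx {x : ℝ} (hx : 0 < x) :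
    Real.log (Rx x) = Real.log x / (3 * Real.log (Real.log x)) := by
  rw [Rx, Real.log_rpow hx]; ring

lemma isSparse_le_div_Lx : IsSparse fun x n => (n : ℝ) ≤ x / Lx x := by
  refine ⟨1, one_pos, ?_⟩
  filter_upwards [eventually_gt_atTop 0, Real.tendsto_log_atTop.eventually_ge_atTop 1,
    tendsto_log_log_atTop.eventually_ge_atTop 1] with x hx hl hll
  have hsub : {n : ℕ | 1 ≤ n ∧ (n : ℝ) ≤ x ∧ (n : ℝ) ≤ x / Lx x} ⊆
      ↑(Finset.Ioc 0 ⌊x / Lx x⌋₊) := fun n hn => by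
    simp only [Finset.coe_Ioc, Set.mem_Ioc]
    exact ⟨hn.1, Nat.le_floor hn.2.2⟩
  have h1 := Set.ncard_le_ncard hsub (Finset.finite_toSet _)
  rw [Set.ncard_coe_finset, Nat.card_Ioc, Nat.sub_zero] at h1
  have hL : 0 < Lx x := by rw [Lx]; positivity
  calc _ ≤ ((⌊x / Lx x⌋₊ : ℕ) : ℝ) := by exact_mod_cast h1
    _ ≤ x / Lx x := Nat.floor_le (by positivity)
    _ ≤ x / Real.log x ^ 2 := by
        rw [Lx]
        gcongr
        norm_num
    _ ≤ _ := by
        rw [one_mul]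
        gcongr
        exact le_mul_of_one_le_right hx.le (one_le_pow₀ hll)

lemma isSparse_sq_dvd : IsSparse fun x n => ∃ d : ℕ, Lx x < (d : ℝ) ∧ d ^ 2 ∣ n := by
  refine ⟨2, two_pos, ?_⟩
  filter_upwards [eventually_gt_atTop 0, Real.tendsto_log_atTop.eventually_ge_atTop 1,
    tendsto_log_log_atTop.eventually_ge_atTop 1] with x hx hl hll
  have hL : 0 < Lx x := by rw [Lx]; positivity
  refine (ncard_le_sum_div hx.le (Finset.Ioo ⌊Lx x⌋₊ (⌊x⌋₊ + 1)) (· ^ 2) _ ?_).trans ?_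
  · rintro n ⟨h1, h2, d, h3, h4⟩
    refine ⟨h1, h2, d, ?_, h4⟩
    rw [Finset.mem_Ioo, Nat.floor_lt hL.le, Nat.lt_succ_iff]
    refine ⟨h3, (Nat.le_self_pow two_ne_zero d).trans ((Nat.le_of_dvd h1 h4).trans ?_)⟩
    exact Nat.le_floor h2
  · have h := sum_Ioo_inv_sq_le (α := ℝ) ⌊Lx x⌋₊ (⌊x⌋₊ + 1)
    push_cast
    simp only [div_eq_mul_inv]
    rw [← Finset.mul_sum]
    calc _ ≤ x * (2 / (⌊Lx x⌋₊ + 1)) := by gcongr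
      _ ≤ x * (2 / Lx x) := by
        gcongr
        exact (Nat.lt_floor_add_one _).le
      _ ≤ x * (2 / Real.log x ^ 2) := by
        rw [Lx]
        gcongr
        norm_num
      _ = 2 * x * 1 * (Real.log x ^ 2)⁻¹ := by ring
      _ ≤ _ := by
        gcongr
        exact one_le_pow₀ hll

lemma isSparse_smooth :
    IsSparse fun x n => ∀ p : ℕ, p.Prime → p ∣ n → (p : ℝ) ≤ Rx x := by
  obtain ⟨C, hC, h⟩ := exists_sum_smooth_rpow_le (c := 48) (by norm_num)
  refine ⟨C, hC, ?_⟩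
  filter_upwards [eventually_gt_atTop 1, Real.tendsto_log_atTop.eventually_ge_atTop 1,
    tendsto_log_log_atTop.eventually_ge_atTop 1, eventually_mul_pow_log_log_le 288 1,
    eventually_exp_log_log] with x hx hl hll hbig hexp
  set l := Real.log (Real.log x) with hl_def
  have hR : Real.log (Rx x) = Real.log x / (3 * l) := log_Rx (by linarith)
  have hR96 : 96 ≤ Real.log (Rx x) := by
    rw [hR, le_div_iff₀ (by positivity)]; linarith
  have hRl : Real.log (Rx x) ≤ Real.log x := by
    rw [hR]; exact div_le_self (by linarith) (by linarith)
  have hR1 : 1 ≤ Rx x := by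
    rw [Rx]; exact Real.one_le_rpow hx.le (by positivity)
  set S := {n : ℕ | 1 ≤ n ∧ (n : ℝ) ≤ x ∧ ∀ p : ℕ, p.Prime → p ∣ n → (p : ℝ) ≤ Rx x} with hS
  have hSf : S.Finite := finite_setOf_le_and x _
  have hsum := h (Rx x) hR1 (by linarith) (by linarith) hSf.toFinset fun n hn => by
    rw [Set.Finite.mem_toFinset] at hn
    exact hn.2.2
  set s := 1 - 48 / Real.log (Rx x) with hs
  have hs0 : 0 ≤ s := by
    have : 48 / Real.log (Rx x) ≤ 1 := by rw [div_le_one (by linarith)]; linarith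
    linarith
  have hxs : x ^ s = x / Real.log x ^ 144 := by
    rw [hs, Real.rpow_sub (by linarith), Real.rpow_one, Real.rpow_def_of_pos (by linarith)]
    congr 1
    have : Real.log x * (48 / Real.log (Rx x)) = (144 : ℕ) * l := by
      rw [hR]
      field_simp
      norm_num
    rw [this, Real.exp_nat_mul, ← hexp]
  calc (S.ncard : ℝ) = ∑ n ∈ hSf.toFinset, (1 : ℝ) := by
        rw [Set.ncard_eq_toFinset_card S hSf]; simp
    _ ≤ ∑ n ∈ hSf.toFinset, x ^ s * (n : ℝ) ^ (-s) := by
        refine Finset.sum_le_sum fun n hn => ?_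
        rw [Set.Finite.mem_toFinset] at hn
        have hn0 : (0 : ℝ) < n := by exact_mod_cast hn.1
        rw [Real.rpow_neg hn0.le, ← div_eq_mul_inv, one_le_div (by positivity)]
        exact Real.rpow_le_rpow hn0.le hn.2.1 hs0
    _ ≤ x ^ s * (C * Real.log (Rx x) ^ 48) := by
        rw [← Finset.mul_sum]; gcongr
    _ ≤ x / Real.log x ^ 144 * (C * Real.log x ^ 48) := by
        rw [hxs]; gcongr
    _ = C * x * 1 / Real.log x ^ 96 := by field_simp
    _ ≤ C * x * l ^ 5 / Real.log x ^ 2 := by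
        gcongr
        · exact one_le_pow₀ hll
        · norm_num

lemma isSparse_smooth_dvd : IsSparse fun x n => ∃ d : ℕ, Dx x < (d : ℝ) ∧
    (∀ p : ℕ, p.Prime → p ∣ d → (p : ℝ) ≤ Lx x) ∧ d ∣ n := by
  obtain ⟨C, hC, h⟩ := exists_sum_smooth_rpow_le (c := 30) (by norm_num)
  refine ⟨C * 10 ^ 48, by positivity, ?_⟩
  filter_upwards [eventually_gt_atTop 1, Real.tendsto_log_atTop.eventually_ge_atTop 1,
    tendsto_log_log_atTop.eventually_ge_atTop 50, eventually_mul_pow_log_log_le 1 43,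
    eventually_exp_log_log] with x hx hl hll hbig hexp
  set l := Real.log (Real.log x) with hl_def
  have hL := log_Lx x
  rw [← hl_def] at hL
  have hL1 : 1 ≤ Lx x := one_le_pow₀ hl
  classical
  set T := (Finset.Icc 1 ⌊x⌋₊).filter fun d : ℕ =>
    Dx x < (d : ℝ) ∧ ∀ p : ℕ, p.Prime → p ∣ d → (p : ℝ) ≤ Lx x with hT
  have hsum := h (Lx x) hL1 (by linarith) (by linarith) T fun n hn =>
    (Finset.mem_filter.1 hn).2.2
  refine (ncard_le_sum_div (zero_le_one.trans hx.le) T id _ ?_).trans ?_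
  · rintro n ⟨h1, h2, d, h3, h4, h5⟩
    refine ⟨h1, h2, d, ?_, h5⟩
    rw [hT, Finset.mem_filter, Finset.mem_Icc]
    exact ⟨⟨Nat.pos_of_dvd_of_pos h5 h1, (Nat.le_of_dvd h1 h5).trans (Nat.le_floor h2)⟩, h3, h4⟩
  · have hD : Dx x ^ (-(30 / Real.log (Lx x))) ≤ (Real.log x ^ 3)⁻¹ := by
      rw [Dx, Real.rpow_def_of_pos (Real.exp_pos _), Real.log_exp, hL, ← hl_def, hexp,
        ← Real.exp_nat_mul, ← Real.exp_neg, Real.exp_le_exp]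
      have : l ^ 3 * -(30 / (10 * l)) = -(3 * l ^ 2) := by field_simp; norm_num
      rw [this]
      push_cast
      nlinarith
    calc ∑ d ∈ T, x / (id d : ℕ)
        ≤ ∑ d ∈ T, x * ((Real.log x ^ 3)⁻¹ * (d : ℝ) ^ (-(1 - 30 / Real.log (Lx x)))) := by
          refine Finset.sum_le_sum fun d hd => ?_
          rw [hT, Finset.mem_filter, Finset.mem_Icc] at hd
          have hd0 : (0 : ℝ) < d := by exact_mod_cast hd.1.1
          rw [id, div_eq_mul_inv]
          gcongr
          have : (d : ℝ)⁻¹ = (d : ℝ) ^ (-(30 / Real.log (Lx x))) *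
              (d : ℝ) ^ (-(1 - 30 / Real.log (Lx x))) := by
            rw [← Real.rpow_add hd0, ← Real.rpow_neg_one]; congr 1; ring
          rw [this]
          gcongr
          refine le_trans (Real.rpow_le_rpow_of_nonpos (Real.exp_pos _) hd.2.1.le ?_) hD
          rw [neg_nonpos, hL]
          positivity
      _ ≤ x * ((Real.log x ^ 3)⁻¹ * (C * Real.log (Lx x) ^ 48)) := by
          rw [← Finset.mul_sum, ← Finset.mul_sum]
          gcongr
      _ = C * 10 ^ 48 * x * l ^ 5 * (1 * l ^ 43) / Real.log x ^ 3 := by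
          rw [hL, mul_pow]; ring
      _ ≤ C * 10 ^ 48 * x * l ^ 5 * Real.log x / Real.log x ^ 3 := by gcongr
      _ = _ := by field_simp

lemma sum_inv_Icc_floor_le {y : ℝ} (hy : 1 ≤ y) :
    ∑ d ∈ Finset.Icc 1 ⌊y⌋₊, (d : ℝ)⁻¹ ≤ 1 + Real.log y := by
  refine le_trans (le_of_eq ?_) (harmonic_floor_le_one_add_log y hy)
  rw [harmonic_eq_sum_Icc]
  push_cast
  rfl

/-- The primes in `[A, B]`. -/
noncomputable def primesBetween (A B : ℝ) : Finset ℕ :=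
  (Finset.Icc ⌈A⌉₊ ⌊B⌋₊).filter Nat.Prime

lemma mem_primesBetween {A B : ℝ} {p : ℕ} :
    p ∈ primesBetween A B ↔ p.Prime ∧ A ≤ p ∧ (p : ℝ) ≤ B := by
  rw [primesBetween, Finset.mem_filter, Finset.mem_Icc, Nat.ceil_le]
  constructor
  · rintro ⟨⟨h1, h2⟩, h3⟩
    exact ⟨h3, h1, (Nat.le_floor_iff' h3.ne_zero).1 h2⟩
  · rintro ⟨h3, h1, h2⟩
    exact ⟨⟨h1, Nat.le_floor h2⟩, h3⟩

lemma sum_inv_primesBetween_le {A B : ℝ} (hA : 1 < A) (hAB : A ≤ B) :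
    ∑ p ∈ primesBetween A B, (p : ℝ)⁻¹ ≤ (4 * Real.log (B / A) + 4) / Real.log A :=
  sum_inv_prime_le hA hAB _ fun _ hp => mem_primesBetween.1 hp

lemma isSparse_three_close_primes :
    IsSparse fun x n => ∃ d p₁ p₂ p₃ : ℕ, n = d * p₃ * p₂ * p₁ ∧ p₁.Prime ∧ p₂.Prime ∧ p₃.Prime ∧
      Rx x / (Lx x) ^ 2 ≤ (p₃ : ℝ) ∧ p₃ ≤ p₂ ∧ p₂ ≤ p₁ ∧ (p₁ : ℝ) ≤ (p₃ : ℝ) * (Lx x) ^ 2 := by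
  refine ⟨504 ^ 2 * 48, by norm_num, ?_⟩
  filter_upwards [eventually_gt_atTop 1, Real.tendsto_log_atTop.eventually_ge_atTop 4,
    tendsto_log_log_atTop.eventually_ge_atTop 1, eventually_mul_pow_log_log_le 120 2]
    with x hx hl hll hbig
  set l := Real.log (Real.log x) with hl_def
  have hx0 : 0 < x := by linarith
  have hL := log_Lx x
  rw [← hl_def] at hL
  have hR : Real.log (Rx x) = Real.log x / (3 * l) := log_Rx hx0
  have hL1 : 1 ≤ Lx x := one_le_pow₀ (by linarith)
  have hR0 : 0 < Rx x := by rw [Rx]; positivity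
  set A := Rx x / Lx x ^ 2 with hA
  have hA0 : 0 < A := by positivity
  have hlogA : Real.log x / (6 * l) ≤ Real.log A := by
    rw [hA, Real.log_div hR0.ne' (by positivity), Real.log_pow, hR, hL]
    have : 20 * l ≤ Real.log x / (6 * l) := by
      rw [le_div_iff₀ (by positivity)]; linarith
    have h2 : Real.log x / (3 * l) = 2 * (Real.log x / (6 * l)) := by field_simp; norm_num
    push_cast
    linarith
  have hlogA0 : 0 < Real.log A := lt_of_lt_of_le (by positivity) hlogA
  have hA1 : 1 < A := (Real.log_pos_iff hA0.le).1 hlogA0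
  have hAx : A ≤ x := by
    rw [← Real.log_le_log_iff hA0 hx0, hA, Real.log_div hR0.ne' (by positivity), Real.log_pow,
      hR, hL]
    have : Real.log x / (3 * l) ≤ Real.log x := div_le_self (by linarith) (by linarith)
    push_cast
    linarith
  set T : Finset (Σ _ : ℕ, ℕ × ℕ) := (primesBetween A x).sigma fun p =>
    primesBetween p (p * Lx x ^ 2) ×ˢ primesBetween p (p * Lx x ^ 2) with hT
  refine (ncard_le_sum_div hx0.le T (fun t => t.1 * t.2.1 * t.2.2) _ ?_).trans ?_
  · rintro n ⟨h1, h2, d, p₁, p₂, p₃, hn, hp₁, hp₂, hp₃, hR3, h32, h21, h13⟩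
    refine ⟨h1, h2, ⟨p₃, p₂, p₁⟩, ?_, ⟨d, by rw [hn]; ring⟩⟩
    rw [hT, Finset.mem_sigma, Finset.mem_product, mem_primesBetween, mem_primesBetween,
      mem_primesBetween]
    have h32' : (p₃ : ℝ) ≤ p₂ := by exact_mod_cast h32
    have h21' : (p₂ : ℝ) ≤ p₁ := by exact_mod_cast h21
    refine ⟨⟨hp₃, hR3, le_trans ?_ h2⟩, ⟨hp₂, h32', h21'.trans h13⟩, hp₁, h32'.trans h21', h13⟩
    exact_mod_cast Nat.le_of_dvd h1 ⟨d * p₂ * p₁, by rw [hn]; ring⟩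
  · have hinner : ∀ p ∈ primesBetween A x,
        ∑ q ∈ primesBetween p (p * Lx x ^ 2), (q : ℝ)⁻¹ ≤ 504 * l ^ 2 / Real.log x := by
      intro p hp
      obtain ⟨-, hAp, -⟩ := mem_primesBetween.1 hp
      have hp1 : (1 : ℝ) < p := by linarith
      have hlp : Real.log A ≤ Real.log p := Real.log_le_log hA0 hAp
      refine (sum_inv_primesBetween_le hp1
        (le_mul_of_one_le_right (by linarith) (one_le_pow₀ hL1))).trans ?_
      rw [mul_div_cancel_left₀ _ (by linarith), Real.log_pow, hL]
      push_cast
      calc (4 * (2 * (10 * l)) + 4) / Real.log p ≤ (84 * l) / (Real.log x / (6 * l)) := by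
            gcongr
            · linarith
            · linarith
        _ = _ := by field_simp; norm_num
    have houter : ∑ p ∈ primesBetween A x, (p : ℝ)⁻¹ ≤ 48 * l := by
      refine (sum_inv_primesBetween_le hA1 hAx).trans ?_
      have : Real.log (x / A) ≤ Real.log x := by
        rw [Real.log_div hx0.ne' hA0.ne']; linarith
      calc (4 * Real.log (x / A) + 4) / Real.log A ≤ (8 * Real.log x) / (Real.log x / (6 * l)) := by
            gcongr
            linarith
        _ = _ := by field_simp; norm_num
    calc ∑ t ∈ T, x / (t.1 * t.2.1 * t.2.2 : ℕ)
        = ∑ p ∈ primesBetween A x, x * ((p : ℝ)⁻¹ *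
            (∑ q ∈ primesBetween p (p * Lx x ^ 2), (q : ℝ)⁻¹) ^ 2) := by
          rw [hT, Finset.sum_sigma]
          refine Finset.sum_congr rfl fun p _ => ?_
          rw [pow_two (∑ q ∈ _, _), Finset.sum_mul_sum, ← Finset.sum_product', Finset.mul_sum,
            Finset.mul_sum]
          refine Finset.sum_congr rfl fun q _ => ?_
          push_cast
          rw [div_eq_mul_inv, mul_inv, mul_inv, mul_assoc]
      _ ≤ ∑ p ∈ primesBetween A x, x * ((p : ℝ)⁻¹ * (504 * l ^ 2 / Real.log x) ^ 2) := by
          gcongr with p hp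
          exact hinner p hp
      _ ≤ x * ((48 * l) * (504 * l ^ 2 / Real.log x) ^ 2) := by
          rw [← Finset.mul_sum, ← Finset.sum_mul]
          gcongr
      _ = _ := by field_simp

lemma isSparse_two_close_primes :
    IsSparse fun x n => (x / Lx x < n) ∧ ∃ d p₁ p₂ : ℕ, n = d * p₂ * p₁ ∧ (d : ℝ) ≤ Dx x ∧
      p₁.Prime ∧ p₂.Prime ∧ p₂ ≤ p₁ ∧ (p₁ : ℝ) ≤ (p₂ : ℝ) * Lx x := by
  obtain ⟨z₀, hz₀⟩ := eventually_atTop.1 (Chebyshev.eventually_primeCounting_le one_pos)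
  refine ⟨12 * 352 * 2, by norm_num, ?_⟩
  filter_upwards [eventually_gt_atTop 1, Real.tendsto_log_atTop.eventually_ge_atTop 4,
    tendsto_log_log_atTop.eventually_ge_atTop 1, eventually_mul_pow_log_log_le 2 3,
    eventually_mul_pow_log_log_le 80 1,
    (Real.tendsto_log_atTop.eventually_ge_atTop (4 * Real.log (max z₀ 1)))]
    with x hx hl hll hD hLbig hz
  set l := Real.log (Real.log x) with hl_def
  have hx0 : 0 < x := by linarith
  have hL := log_Lx x
  rw [← hl_def] at hL
  have hL1 : 1 ≤ Lx x := one_le_pow₀ (by linarith)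
  have hD1 : 1 ≤ Dx x := Real.one_le_exp (by positivity)
  have hlogD : Real.log (Dx x) = l ^ 3 := Real.log_exp _
  set T : Finset (Σ _ : ℕ, ℕ) := (Finset.Icc 1 ⌊Dx x⌋₊).sigma fun d =>
    primesBetween (√(x / d) / Lx x) √(x / d) with hT
  have hd : ∀ d ∈ Finset.Icc 1 ⌊Dx x⌋₊, (0 : ℝ) < d ∧ Real.log x / 4 ≤ Real.log √(x / d) := by
    intro d hd
    rw [Finset.mem_Icc, Nat.le_floor_iff (by linarith)] at hd
    have hd0 : (0 : ℝ) < d := by exact_mod_cast hd.1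
    refine ⟨hd0, ?_⟩
    have := Real.log_le_log hd0 hd.2
    rw [Real.log_sqrt (by positivity), Real.log_div hx0.ne' hd0.ne']
    linarith
  refine (ncard_le_sum_primeCounting (x := x) T (fun t => t.1 * t.2) _ ?_).trans ?_
  · rintro n ⟨h1, h2, hn, d, p₁, p₂, rfl, hdD, hp₁, hp₂, h21, h12⟩
    refine ⟨h1, h2, ⟨d, p₂⟩, ?_, p₁, hp₁, rfl⟩
    have hd1 : 1 ≤ d := by
      rw [Nat.one_le_iff_ne_zero]; rintro rfl; simp at h1
    have hd0 : (0 : ℝ) < d := by exact_mod_cast hd1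
    have h21' : (p₂ : ℝ) ≤ p₁ := by exact_mod_cast h21
    have hp0 : (0 : ℝ) < p₂ := by exact_mod_cast hp₂.pos
    have hL0 : 0 < Lx x := by linarith
    push_cast at h2 hn
    rw [hT, Finset.mem_sigma, Finset.mem_Icc, mem_primesBetween]
    refine ⟨⟨hd1, Nat.le_floor hdD⟩, hp₂, ?_, Real.le_sqrt_of_sq_le ?_⟩
    · dsimp only
      rw [div_le_iff₀ hL0]
      refine Real.sqrt_le_iff.2 ⟨by positivity, ?_⟩
      rw [div_le_iff₀ hd0]
      rw [div_lt_iff₀ hL0] at hn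
      calc x ≤ d * p₂ * p₁ * Lx x := hn.le
        _ ≤ d * p₂ * (p₂ * Lx x) * Lx x := by gcongr
        _ = _ := by ring
    · dsimp only
      rw [le_div_iff₀ hd0]
      calc (p₂ : ℝ) ^ 2 * d = d * p₂ * p₂ := by ring
        _ ≤ d * p₂ * p₁ := by gcongr
        _ ≤ x := h2
  · have hpi : ∀ t ∈ T, (Nat.primeCounting ⌊x / (t.1 * t.2 : ℕ)⌋₊ : ℝ) ≤
        12 * x / Real.log x * ((t.1 : ℝ)⁻¹ * (t.2 : ℝ)⁻¹) := by
      rintro ⟨d, p⟩ ht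
      rw [hT, Finset.mem_sigma, mem_primesBetween] at ht
      obtain ⟨ht, hp, -, hp2⟩ := ht
      obtain ⟨hd0, hdl⟩ := hd d ht
      have hp0 : (0 : ℝ) < p := by exact_mod_cast hp.pos
      dsimp only at hp2 ⊢
      push_cast
      have hs0 : 0 < √(x / d) := by positivity
      have hsz : √(x / d) ≤ x / (d * p) := by
        rw [← div_div, le_div_iff₀ hp0]
        calc √(x / d) * p ≤ √(x / d) * √(x / d) := by gcongr
          _ = x / d := Real.mul_self_sqrt (by positivity)
      have hzl : Real.log x / 4 ≤ Real.log (x / (d * p)) := hdl.trans (Real.log_le_log hs0 hsz)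
      have hzz : z₀ ≤ x / (d * p) := by
        refine (le_max_left z₀ 1).trans ?_
        rw [← Real.log_le_log_iff (by positivity) (by positivity)]
        linarith
      refine (hz₀ _ hzz).trans ?_
      have hlog4 : Real.log 4 + 1 ≤ 3 := by
        rw [show (4 : ℝ) = 2 ^ 2 by norm_num, Real.log_pow]
        have := Real.log_two_lt_d9
        push_cast
        linarith
      calc (Real.log 4 + 1) * (x / (d * p)) / Real.log (x / (d * p))
          ≤ 3 * (x / (d * p)) / (Real.log x / 4) := by gcongr
        _ = _ := by field_simp; norm_num
    have hinner : ∀ d ∈ Finset.Icc 1 ⌊Dx x⌋₊,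
        ∑ p ∈ primesBetween (√(x / d) / Lx x) √(x / d), (p : ℝ)⁻¹ ≤ 352 * l / Real.log x := by
      intro d h
      obtain ⟨hd0, hdl⟩ := hd d h
      have hs0 : 0 < √(x / d) := by positivity
      have hlog : Real.log x / 8 ≤ Real.log (√(x / d) / Lx x) := by
        rw [Real.log_div hs0.ne' (by positivity), hL]
        linarith
      have hq0 : 0 < √(x / d) / Lx x := by positivity
      have hq1 : 1 < √(x / d) / Lx x := (Real.log_pos_iff hq0.le).1 (by linarith)
      refine (sum_inv_primesBetween_le hq1 (div_le_self hs0.le hL1)).trans ?_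
      rw [div_div_cancel₀ hs0.ne', hL]
      calc (4 * (10 * l) + 4) / Real.log (√(x / d) / Lx x) ≤ (44 * l) / (Real.log x / 8) := by
            gcongr
            linarith
        _ = _ := by field_simp; norm_num
    have houter : ∑ d ∈ Finset.Icc 1 ⌊Dx x⌋₊, (d : ℝ)⁻¹ ≤ 2 * l ^ 3 := by
      refine (sum_inv_Icc_floor_le hD1).trans ?_
      rw [hlogD]
      have : 1 ≤ l ^ 3 := one_le_pow₀ hll
      linarith
    calc ∑ t ∈ T, (Nat.primeCounting ⌊x / (t.1 * t.2 : ℕ)⌋₊ : ℝ)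
        ≤ ∑ t ∈ T, 12 * x / Real.log x * ((t.1 : ℝ)⁻¹ * (t.2 : ℝ)⁻¹) := Finset.sum_le_sum hpi
      _ = 12 * x / Real.log x * ∑ d ∈ Finset.Icc 1 ⌊Dx x⌋₊, (d : ℝ)⁻¹ *
            ∑ p ∈ primesBetween (√(x / d) / Lx x) √(x / d), (p : ℝ)⁻¹ := by
          rw [← Finset.mul_sum, hT, Finset.sum_sigma]
          simp only [Finset.mul_sum]
      _ ≤ 12 * x / Real.log x * ∑ d ∈ Finset.Icc 1 ⌊Dx x⌋₊, (d : ℝ)⁻¹ *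
            (352 * l / Real.log x) := by
          gcongr with d h
          exact hinner d h
      _ ≤ 12 * x / Real.log x * ((2 * l ^ 3) * (352 * l / Real.log x)) := by
          rw [← Finset.sum_mul]
          gcongr
      _ = 12 * 352 * 2 * x * l ^ 4 / Real.log x ^ 2 := by field_simp
      _ ≤ _ := by
          gcongr
          norm_num

lemma isSparse_inE : IsSparse inE := by
  refine ((((isSparse_le_div_Lx.or isSparse_smooth).or isSparse_sq_dvd).or
    isSparse_smooth_dvd).or (isSparse_two_close_primes.or isSparse_three_close_primes)).mono ?_
  refine Eventually.of_forall fun x n _ _ h => ?_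
  rcases h with h | h | h | h | ⟨d, p₁, p₂, hn, hd, hp₁, hp₂, -, h21, h12⟩ | h
  · exact Or.inl (Or.inl (Or.inl (Or.inl h)))
  · exact Or.inl (Or.inl (Or.inl (Or.inr h)))
  · exact Or.inl (Or.inl (Or.inr h))
  · exact Or.inl (Or.inr h)
  · by_cases hnx : (n : ℝ) ≤ x / Lx x
    · exact Or.inl (Or.inl (Or.inl (Or.inl hnx)))
    · by_cases hdD : (d : ℝ) ≤ Dx x
      · exact Or.inr (Or.inl ⟨not_le.1 hnx, d, p₁, p₂, hn, hdD, hp₁, hp₂, h21, h12⟩)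
      · exact Or.inl (Or.inr ⟨d, not_le.1 hdD, hd, ⟨p₂ * p₁, by rw [hn, mul_assoc]⟩⟩)
  · exact Or.inr (Or.inr h)

theorem stmt8 : ∃ C : ℝ, 0 < C ∧ ∃ x₀ : ℝ, ∀ x : ℝ, x₀ ≤ x →
    ({n : ℕ | 1 ≤ n ∧ (n : ℝ) ≤ x ∧ inE x n}.ncard : ℝ) ≤
      C * x * (Real.log (Real.log x)) ^ 5 / (Real.log x) ^ 2 := by
  obtain ⟨C, hC, h⟩ := isSparse_inE
  obtain ⟨x₀, hx₀⟩ := eventually_atTop.1 h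
  exact ⟨C, hC, x₀, hx₀⟩
end

section
/- There is an absolute constant C > 0 such that for all sufficiently large real x, with L = (log x)^{10}, if A₂ is the set of natural numbers n ≤ x of the form n = d·p·s, where p is a prime greater than L, all prime factors of d are strictly less than p, and s is either a prime or a product of two primes all of whose prime factors exceed p·L, then M(A₂) ≤ C·x/(log x)². -/
open scoped BigOperators

/-- `M A` is the largest cardinality of a subset of `A` on which the Euler totient
function is nondecreasing. -/
noncomputable def M (A : Set ℕ) : ℕ :=
  sSup {k : ℕ | ∃ B : Finset ℕ, ↑B ⊆ A ∧
    (∀ m ∈ B, ∀ n ∈ B, m ≤ n → Nat.totient m ≤ Nat.totient n) ∧ B.card = k}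

/-- Membership in the secondary set `A₂`: `n = d * p * s` with `p` a prime exceeding `L`,
all prime factors of `d` less than `p`, and `s` an almost prime (a prime or a product of two
primes) all of whose prime factors exceed `p * L`. -/
def inA2 (x : ℝ) (n : ℕ) : Prop :=
  ∃ d p s : ℕ, n = d * p * s ∧ p.Prime ∧ Lx x < (p : ℝ) ∧
    (∀ q : ℕ, q.Prime → q ∣ d → q < p) ∧
    (s.Prime ∨ ∃ q₁ q₂ : ℕ, q₁.Prime ∧ q₂.Prime ∧ s = q₁ * q₂) ∧
    (∀ q : ℕ, q.Prime → q ∣ s → (p : ℝ) * Lx x < (q : ℝ))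

/-- If `p n` divides `n / d`, lies in `[P, 2P)`, and is nondecreasing up to an error `Δ` on a
set `S` contained in an interval of length `h`, then `S` is small: the quantity
`⌊(n - a) / (d P)⌋ + ⌊(p n - P) / Δ⌋` has fibres of size at most `2 Δ`. -/
lemma card_le_of_almost_monotone_divisor (S : Finset ℕ) (p : ℕ → ℕ) {d P Δ h a : ℕ} (hd : 0 < d)
    (hP : 0 < P) (hΔ : 0 < Δ) (hS : ∀ n ∈ S, a ≤ n ∧ n < a + h)
    (hdvd : ∀ n ∈ S, d * p n ∣ n) (hp : ∀ n ∈ S, P ≤ p n ∧ p n < 2 * P)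
    (hmono : ∀ m ∈ S, ∀ n ∈ S, m < n → p m ≤ p n + Δ) :
    S.card ≤ (2 * Δ) * (h / (d * P) + P / Δ + 1) := by
  classical
  have hdP : 0 < d * P := Nat.mul_pos hd hP
  set u : ℕ → ℕ := fun n => (n - a) / (d * P) with hu
  set v : ℕ → ℕ := fun n => (p n - P) / Δ with hv
  have hmaps : ∀ n ∈ S, u n + v n ∈ Finset.range (h / (d * P) + P / Δ + 1) := by
    intro n hn
    have h1 := hS n hn
    have h2 := hp n hn
    have h3 : u n ≤ h / (d * P) := Nat.div_le_div_right (by omega)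
    have h4 : v n ≤ P / Δ := Nat.div_le_div_right (by omega)
    rw [Finset.mem_range]
    omega
  have hvm : ∀ m ∈ S, ∀ n ∈ S, m ≤ n → v m ≤ v n + 1 := by
    intro m hm n hn hmn
    rcases hmn.eq_or_lt with rfl | hlt
    · omega
    have h1 := hmono m hm n hn hlt
    have h2 := hp m hm
    have h3 := hp n hn
    calc v m ≤ (p n - P + Δ) / Δ := Nat.div_le_div_right (by omega)
      _ = v n + 1 := Nat.add_div_right _ hΔ
  have hum : ∀ m n : ℕ, m ≤ n → u m ≤ u n := fun m n hmn =>
    Nat.div_le_div_right (Nat.sub_le_sub_right hmn a)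
  have hinj : ∀ m ∈ S, ∀ n ∈ S, m ≤ n → u m = u n → p m = p n → m = n := by
    intro m hm n hn hmn huu hpp
    have h1 := hS m hm
    have h2 := hS n hn
    have hlt : n - m < d * p m := by
      have e1 := Nat.div_add_mod (m - a) (d * P)
      have e2 := Nat.div_add_mod (n - a) (d * P)
      have e3 := Nat.mod_lt (n - a) hdP
      have e4 : d * P ≤ d * p m := Nat.mul_le_mul_left d (hp m hm).1
      have e5 : (m - a) / (d * P) = (n - a) / (d * P) := huu
      rw [e5] at e1
      omega
    have hdiv : d * p m ∣ n - m := by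
      refine Nat.dvd_sub ?_ (hdvd m hm)
      rw [hpp]
      exact hdvd n hn
    have := Nat.eq_zero_of_dvd_of_lt hdiv hlt
    omega
  have hfib : ∀ t ∈ Finset.range (h / (d * P) + P / Δ + 1),
      (S.filter (fun n => u n + v n = t)).card ≤ 2 * Δ := by
    intro t _
    rcases (S.filter (fun n => u n + v n = t)).eq_empty_or_nonempty with he | hne
    · rw [he]; simp
    set F := S.filter (fun n => u n + v n = t) with hF
    set n₀ := F.min' hne with hn₀
    have hn₀F : n₀ ∈ F := F.min'_mem hne
    have hmemF : ∀ n ∈ F, n ∈ S ∧ u n + v n = t := fun n hn => by simpa [hF] using hn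
    have hun : ∀ n ∈ F, u n₀ ≤ u n ∧ u n ≤ u n₀ + 1 := by
      intro n hn
      have hle : n₀ ≤ n := F.min'_le n hn
      have h1 := hvm n₀ (hmemF _ hn₀F).1 n (hmemF _ hn).1 hle
      have h2 := hum n₀ n hle
      have h3 := (hmemF _ hn).2
      have h4 := (hmemF _ hn₀F).2
      omega
    have hcard : F.card ≤ (Finset.range 2 ×ˢ Finset.range Δ).card := by
      refine Finset.card_le_card_of_injOn (fun n => (u n - u n₀, (p n - P) % Δ)) ?_ ?_
      · intro n hn
        have h1 := hun n hn
        have h2 := Nat.mod_lt (p n - P) hΔ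
        simp only [Finset.coe_product, Set.mem_prod, Finset.mem_coe, Finset.mem_range]
        omega
      · intro m hm n hn hmn
        have hm1 := hun m hm
        have hn1 := hun n hn
        have hm2 := hmemF m hm
        have hn2 := hmemF n hn
        simp only [Prod.mk.injEq] at hmn
        have huu : u m = u n := by omega
        have hvv : (p m - P) / Δ = (p n - P) / Δ := by
          change v m = v n
          omega
        have e1 := Nat.div_add_mod (p m - P) Δ
        have e2 := Nat.div_add_mod (p n - P) Δ
        have hpp : p m = p n := by
          have h1 := hp m hm2.1
          have h2 := hp n hn2.1
          rw [hvv, hmn.2] at e1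
          omega
        rcases le_total m n with hle | hle
        · exact hinj m hm2.1 n hn2.1 hle huu hpp
        · exact (hinj n hn2.1 m hm2.1 hle huu.symm hpp.symm).symm
    simpa using hcard
  have := Finset.card_le_mul_card_image_of_maps_to hmaps (2 * Δ) hfib
  simpa using this

/-- A prime, or product of two primes, whose prime factors exceed `y` has totient close to
itself. -/
lemma almostPrime_mul_le_totient {s : ℕ} {y : ℝ} (hy : 0 < y)
    (hs : s.Prime ∨ ∃ q₁ q₂ : ℕ, q₁.Prime ∧ q₂.Prime ∧ s = q₁ * q₂)
    (hq : ∀ q : ℕ, q.Prime → q ∣ s → y < (q : ℝ)) :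
    (s : ℝ) * (1 - 2 / y) ≤ (Nat.totient s : ℝ) := by
  have key : ∀ q : ℕ, y < (q : ℝ) → 1 ≤ (q : ℝ) / y := fun q h => by
    rw [le_div_iff₀ hy]; linarith
  rcases hs with hs | ⟨q₁, q₂, h₁, h₂, rfl⟩
  · have h := key s (hq s hs dvd_rfl)
    rw [Nat.totient_prime hs, Nat.cast_sub hs.one_le]
    have : (s : ℝ) * (1 - 2 / y) = s - 2 * (s / y) := by ring
    push_cast
    linarith
  · have k₁ := key q₁ (hq q₁ h₁ (dvd_mul_right _ _))
    have k₂ := key q₂ (hq q₂ h₂ (dvd_mul_left _ _))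
    have hsup : ((q₁ : ℝ) - 1) * (q₂ - 1) ≤ (Nat.totient (q₁ * q₂) : ℝ) := by
      have h := Nat.totient_super_multiplicative q₁ q₂
      rw [Nat.totient_prime h₁, Nat.totient_prime h₂] at h
      have h' : (((q₁ - 1) * (q₂ - 1) : ℕ) : ℝ) ≤ (Nat.totient (q₁ * q₂) : ℝ) := by
        exact_mod_cast h
      rwa [Nat.cast_mul, Nat.cast_sub h₁.one_le, Nat.cast_sub h₂.one_le, Nat.cast_one] at h'
    have e : ((q₁ * q₂ : ℕ) : ℝ) * (1 - 2 / y) =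
        q₁ * q₂ - q₂ * (q₁ / y) - q₁ * (q₂ / y) := by push_cast; ring
    have f₁ : (q₂ : ℝ) ≤ q₂ * (q₁ / y) := le_mul_of_one_le_right (by positivity) k₁
    have f₂ : (q₁ : ℝ) ≤ q₁ * (q₂ / y) := le_mul_of_one_le_right (by positivity) k₂
    rw [e]
    nlinarith

/-- The totient of `d * p * s` when the prime factors of `d`, `p`, `s` are increasing. -/
lemma totient_mul_mul_of_separated {d p s : ℕ} (hp : p.Prime)
    (hd : ∀ q : ℕ, q.Prime → q ∣ d → q < p) (hs : ∀ q : ℕ, q.Prime → q ∣ s → p < q) :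
    Nat.totient (d * p * s) = Nat.totient d * (p - 1) * Nat.totient s := by
  have h₁ : Nat.Coprime d p := by
    refine Nat.coprime_of_dvd fun q hq hqd hqp => ?_
    have := (Nat.prime_dvd_prime_iff_eq hq hp).1 hqp
    exact absurd (hd q hq hqd) (by omega)
  have h₂ : Nat.Coprime (d * p) s := by
    refine Nat.coprime_of_dvd fun q hq hqd hqs => ?_
    have hlt := hs q hq hqs
    rcases (Nat.Prime.dvd_mul hq).1 hqd with h | h
    · exact absurd (hd q hq h) (by omega)
    · have := (Nat.prime_dvd_prime_iff_eq hq hp).1 h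
      omega
  rw [Nat.totient_mul h₂, Nat.totient_mul h₁, Nat.totient_prime hp]

/-- A representation `n = d * p * s` as in the definition of `inA2`. -/
def IsRep (L : ℝ) (n d p s : ℕ) : Prop :=
  n = d * p * s ∧ p.Prime ∧ L < (p : ℝ) ∧
    (∀ q : ℕ, q.Prime → q ∣ d → q < p) ∧
    (s.Prime ∨ ∃ q₁ q₂ : ℕ, q₁.Prime ∧ q₂.Prime ∧ s = q₁ * q₂) ∧
    (∀ q : ℕ, q.Prime → q ∣ s → (p : ℝ) * L < (q : ℝ))

lemma IsRep.d_pos {L : ℝ} {n d p s : ℕ} (h : IsRep L n d p s) : 0 < d := by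
  obtain ⟨-, hp, -, hd, -⟩ := h
  rcases Nat.eq_zero_or_pos d with rfl | h0
  · exact absurd (hd p hp (dvd_zero p)) (lt_irrefl p)
  · exact h0

lemma IsRep.lt_s {L : ℝ} {n d p s : ℕ} (h : IsRep L n d p s) : (p : ℝ) * L < s := by
  obtain ⟨-, -, -, -, hs, hq⟩ := h
  rcases hs with hs | ⟨q₁, q₂, h₁, h₂, rfl⟩
  · exact hq s hs dvd_rfl
  · refine (hq q₁ h₁ (dvd_mul_right _ _)).trans_le ?_
    exact_mod_cast Nat.le_mul_of_pos_right q₁ h₂.pos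

lemma IsRep.totient_eq {L : ℝ} {n d p s : ℕ} (hL : 1 ≤ L) (h : IsRep L n d p s) :
    Nat.totient n = Nat.totient d * (p - 1) * Nat.totient s := by
  obtain ⟨rfl, hp, -, hd, -, hq⟩ := h
  refine totient_mul_mul_of_separated hp hd fun q hqp hqs => ?_
  have h1 := hq q hqp hqs
  have h2 : (p : ℝ) ≤ p * L := le_mul_of_one_le_right (by positivity) hL
  exact_mod_cast h2.trans_lt h1

/-- If `φ m ≤ φ n` with `m ≤ n` very close together and sharing the factor `d`, then the
distinguished prime of `m` cannot be much larger than that of `n`. -/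
lemma IsRep.prime_le {L E P : ℝ} {m n d p s p' s' : ℕ} (hP : 0 < P) (hE : 0 < E) (hEL : E ≤ L)
    (hL : 1 ≤ L) (hm : IsRep L m d p s) (hn : IsRep L n d p' s')
    (hp : P ≤ p ∧ (p : ℝ) < 2 * P) (hp' : P ≤ p' ∧ (p' : ℝ) < 2 * P)
    (hclose : (n : ℝ) ≤ m * (1 + 1 / (P * E))) (hφ : Nat.totient m ≤ Nat.totient n) :
    (p : ℝ) ≤ p' + 12 * P / E := by
  have hd := hm.d_pos
  have hp0 : (0 : ℝ) < p := hP.trans_le hp.1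
  have hp0' : (0 : ℝ) < p' := hP.trans_le hp'.1
  have hL0 : 0 < L := by linarith
  have hs0 : (0 : ℝ) < s := lt_trans (by positivity) hm.lt_s
  have hm0 : (0 : ℝ) < m := by
    rw [hm.1]; push_cast; positivity
  rw [hm.totient_eq hL, hn.totient_eq hL, mul_assoc, mul_assoc] at hφ
  have hφ1 := Nat.le_of_mul_le_mul_left hφ (Nat.totient_pos.2 hd)
  have hφ2 : ((p : ℝ) - 1) * Nat.totient s ≤ (p' - 1) * Nat.totient s' := by
    have h : (((p - 1) * Nat.totient s : ℕ) : ℝ) ≤ (((p' - 1) * Nat.totient s' : ℕ) : ℝ) := by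
      exact_mod_cast hφ1
    rwa [Nat.cast_mul, Nat.cast_mul, Nat.cast_sub hm.2.1.one_le, Nat.cast_sub hn.2.1.one_le,
      Nat.cast_one] at h
  have h1p : (1 : ℝ) ≤ p := by exact_mod_cast hm.2.1.one_le
  have h1p' : (1 : ℝ) ≤ p' := by exact_mod_cast hn.2.1.one_le
  have hlow := almostPrime_mul_le_totient (by positivity) hm.2.2.2.2.1 hm.2.2.2.2.2
  have hup : (Nat.totient s' : ℝ) ≤ s' := by exact_mod_cast Nat.totient_le s'
  have hφ3 : ((p : ℝ) - 1) * (s * (1 - 2 / (p * L))) ≤ (p' - 1) * s' :=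
    (mul_le_mul_of_nonneg_left hlow (by linarith)).trans
      (hφ2.trans (mul_le_mul_of_nonneg_left hup (by linarith)))
  have hφ4 : (m : ℝ) * ((1 - 1 / p) * (1 - 2 / (p * L))) ≤ n * (1 - 1 / p') := by
    have e1 : (m : ℝ) * ((1 - 1 / p) * (1 - 2 / (p * L))) =
        d * ((p - 1) * (s * (1 - 2 / (p * L)))) := by
      rw [hm.1]; push_cast; field_simp
    have e2 : (n : ℝ) * (1 - 1 / p') = d * ((p' - 1) * s') := by
      rw [hn.1]; push_cast; field_simp
    rw [e1, e2]
    exact mul_le_mul_of_nonneg_left hφ3 (by positivity)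
  have hp1' : 0 ≤ 1 - 1 / (p' : ℝ) := by
    rw [sub_nonneg, div_le_one hp0']; exact h1p'
  have hφ5 : (1 - 1 / (p : ℝ)) * (1 - 2 / (p * L)) ≤ (1 + 1 / (P * E)) * (1 - 1 / p') := by
    have h := hφ4.trans (mul_le_mul_of_nonneg_right hclose hp1')
    rw [mul_assoc] at h
    exact le_of_mul_le_mul_left h hm0
  have ha : 2 / ((p : ℝ) * L) ≤ 2 / (P * E) := by
    apply div_le_div_of_nonneg_left (by norm_num) (by positivity)
    exact mul_le_mul hp.1 hEL hE.le hp0.le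
  have hb : 0 ≤ 1 / (p : ℝ) * (2 / (p * L)) := by positivity
  have hc : 0 ≤ 1 / (P * E) * (1 / (p' : ℝ)) := by positivity
  have hd' : 1 / (p' : ℝ) - 1 / p ≤ 3 / (P * E) := by
    have e : 3 / (P * E) = 2 / (P * E) + 1 / (P * E) := by ring
    rw [e]
    nlinarith
  have he : (p : ℝ) - p' = (1 / (p' : ℝ) - 1 / p) * (p * p') := by
    field_simp
  have hf : (p : ℝ) * p' ≤ 2 * P * (2 * P) :=
    mul_le_mul hp.2.le hp'.2.le hp0'.le (by positivity)
  have hg : (p : ℝ) - p' ≤ 3 / (P * E) * (2 * P * (2 * P)) := by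
    rw [he]
    exact (mul_le_mul_of_nonneg_right hd' (by positivity)).trans
      (mul_le_mul_of_nonneg_left hf (by positivity))
  have hh : 3 / (P * E) * (2 * P * (2 * P)) = 12 * P / E := by
    field_simp; norm_num
  linarith

/-- The contribution of a single `d` and a single dyadic range `[P, 2P)` of the distinguished
prime. -/
lemma card_le_of_fixed_d_and_dyadic {x l : ℝ} (hl : 100 ≤ l) (S : Finset ℕ) (p s : ℕ → ℕ)
    {d P : ℕ} (hrep : ∀ n ∈ S, IsRep (l ^ 10) n d (p n) (s n))
    (hp : ∀ n ∈ S, P ≤ p n ∧ p n < 2 * P)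
    (hx : ∀ n ∈ S, x / l ^ 2 ≤ n ∧ (n : ℝ) ≤ x)
    (hφ : ∀ m ∈ S, ∀ n ∈ S, m ≤ n → Nat.totient m ≤ Nat.totient n) (hd : 0 < d) (hx0 : 0 ≤ x) :
    (S.card : ℝ) ≤ 156 * x / (d * l ^ 4) := by
  classical
  have hl0 : 0 < l := by linarith
  have hdR : (0 : ℝ) < d := by exact_mod_cast hd
  rcases S.eq_empty_or_nonempty with rfl | ⟨n₀, hn₀⟩
  · simp only [Finset.card_empty, Nat.cast_zero]; positivity
  have hr₀ := hrep n₀ hn₀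
  have hp₀ : (P : ℝ) ≤ p n₀ := by exact_mod_cast (hp n₀ hn₀).1
  have hp₀' : (p n₀ : ℝ) < 2 * P := by exact_mod_cast (hp n₀ hn₀).2
  have hl4 : (100 : ℝ) ^ 4 ≤ l ^ 4 := pow_le_pow_left₀ (by norm_num) hl 4
  have hl6 : (100 : ℝ) ^ 6 ≤ l ^ 6 := pow_le_pow_left₀ (by norm_num) hl 6
  have hPl : l ^ 4 ≤ P := by
    have h1 : l ^ 10 < 2 * P := hr₀.2.2.1.trans hp₀'
    have h2 : l ^ 4 * 100 ^ 6 ≤ l ^ 4 * l ^ 6 := mul_le_mul_of_nonneg_left hl6 (by positivity)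
    have h3 : (0 : ℝ) ≤ l ^ 4 := by positivity
    linarith
  have hP0 : (0 : ℝ) < P := lt_of_lt_of_le (by positivity) hPl
  have hP0' : 0 < P := by exact_mod_cast hP0
  have hxd : d * P ^ 2 * l ^ 10 ≤ x := by
    have h1 := hr₀.lt_s.le
    have h2 : (P : ℝ) * (P * l ^ 10) ≤ p n₀ * s n₀ :=
      mul_le_mul hp₀ ((mul_le_mul_of_nonneg_right hp₀ (by positivity)).trans h1)
        (by positivity) (by positivity)
    have h3 : (n₀ : ℝ) = d * (p n₀ * s n₀) := by
      conv_lhs => rw [hr₀.1]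
      push_cast; ring
    calc (d : ℝ) * P ^ 2 * l ^ 10 = d * (P * (P * l ^ 10)) := by ring
      _ ≤ (d : ℝ) * (p n₀ * s n₀) := mul_le_mul_of_nonneg_left h2 hdR.le
      _ = n₀ := h3.symm
      _ ≤ x := (hx n₀ hn₀).2
  set H : ℝ := x / (P * l ^ 6) with hH
  have hxH : x = H * (P * l ^ 6) := by rw [hH]; field_simp
  have hd1 : (1 : ℝ) ≤ d := by exact_mod_cast hd
  have hP1 : (1 : ℝ) ≤ P := by exact_mod_cast hP0'
  have hH1 : 1 ≤ H := by
    rw [hH, le_div_iff₀ (by positivity), one_mul]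
    refine le_trans ?_ hxd
    have h2 : (1 : ℝ) ≤ d * P * l ^ 4 := one_le_mul_of_one_le_of_one_le
      (one_le_mul_of_one_le_of_one_le hd1 hP1) (by linarith)
    calc (P : ℝ) * l ^ 6 ≤ P * l ^ 6 * (d * P * l ^ 4) :=
          le_mul_of_one_le_right (by positivity) h2
      _ = d * P ^ 2 * l ^ 10 := by ring
  set h : ℕ := ⌊H⌋₊ with hh
  have hhH : (h : ℝ) ≤ H := Nat.floor_le (by linarith)
  have hh1 : 1 ≤ h := Nat.le_floor (by exact_mod_cast hH1)
  have hhH' : H ≤ 2 * h := by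
    have h1 := Nat.lt_floor_add_one H
    have h2 : (1 : ℝ) ≤ h := by exact_mod_cast hh1
    rw [← hh] at h1
    linarith
  set Δ : ℕ := ⌊12 * P / l ^ 4⌋₊ + 1 with hΔ
  have hΔlow : 12 * P / l ^ 4 ≤ (Δ : ℝ) := by
    rw [hΔ]; push_cast; exact (Nat.lt_floor_add_one _).le
  have hΔup : (Δ : ℝ) ≤ 13 * P / l ^ 4 := by
    have h1 : ((⌊12 * P / l ^ 4⌋₊ : ℕ) : ℝ) ≤ 12 * P / l ^ 4 := Nat.floor_le (by positivity)
    have h2 : 1 ≤ P / l ^ 4 := by rwa [le_div_iff₀ (by positivity), one_mul]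
    have h3 : 13 * P / l ^ 4 = 12 * P / l ^ 4 + P / l ^ 4 := by ring
    rw [hΔ]; push_cast
    linarith
  have hΔP : (Δ : ℝ) ≤ P := by
    refine hΔup.trans ?_
    rw [div_le_iff₀ (by positivity), mul_comm]
    exact mul_le_mul_of_nonneg_left (by linarith) hP0.le
  have hΔ0 : 0 < Δ := Nat.succ_pos _
  set N : ℕ := ⌊x⌋₊ with hN
  have hmaps : ∀ n ∈ S, n / h ∈ Finset.range (N / h + 1) := by
    intro n hn
    rw [Finset.mem_range]
    exact Nat.lt_succ_of_le (Nat.div_le_div_right (Nat.le_floor (hx n hn).2))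
  have hfib : ∀ i ∈ Finset.range (N / h + 1), (S.filter (fun n => n / h = i)).card ≤
      (2 * Δ) * (h / (d * P) + P / Δ + 1) := by
    intro i _
    have hmem : ∀ n ∈ S.filter (fun n => n / h = i), n ∈ S ∧ i * h ≤ n ∧ n < i * h + h := by
      intro n hn
      rw [Finset.mem_filter] at hn
      have e1 := Nat.div_add_mod n h
      have e2 := Nat.mod_lt n hh1
      rw [hn.2, mul_comm] at e1
      exact ⟨hn.1, by omega, by omega⟩
    refine card_le_of_almost_monotone_divisor _ p (a := i * h) hd hP0' hΔ0
      (fun n hn => (hmem n hn).2) ?_ (fun n hn => hp n (hmem n hn).1) ?_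
    · intro n hn
      exact ⟨s n, (hrep n (hmem n hn).1).1⟩
    · intro m hm n hn hmn
      obtain ⟨hmS, hm1, hm2⟩ := hmem m hm
      obtain ⟨hnS, hn1, hn2⟩ := hmem n hn
      have hpm : (P : ℝ) ≤ p m ∧ (p m : ℝ) < 2 * P := by exact_mod_cast hp m hmS
      have hpn : (P : ℝ) ≤ p n ∧ (p n : ℝ) < 2 * P := by exact_mod_cast hp n hnS
      have hclose : (n : ℝ) ≤ m * (1 + 1 / (P * l ^ 4)) := by
        have h1 : (n : ℝ) ≤ m + h := by exact_mod_cast (by omega : n ≤ m + h)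
        have h2 : H = x / l ^ 2 * (1 / (P * l ^ 4)) := by
          rw [hH]; field_simp
        have h3 : H ≤ m * (1 / (P * l ^ 4)) := by
          rw [h2]
          exact mul_le_mul_of_nonneg_right (hx m hmS).1 (by positivity)
        linarith
      have hEL : l ^ 4 ≤ l ^ 10 := pow_le_pow_right₀ (by linarith) (by norm_num)
      have := (hrep m hmS).prime_le hP0 (by positivity) hEL (by linarith) (hrep n hnS) hpm hpn
        hclose (hφ m hmS n hnS hmn.le)
      have h4 : (p m : ℝ) ≤ p n + Δ := by linarith
      exact_mod_cast h4
  have hcard := Finset.card_le_mul_card_image_of_maps_to hmaps _ hfib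
  rw [Finset.card_range] at hcard
  have hcardR : (S.card : ℝ) ≤
      ((2 * Δ) * ((h / (d * P) : ℕ) + (P / Δ : ℕ) + 1)) * ((N / h : ℕ) + 1) := by
    exact_mod_cast hcard
  have hΔR : (0 : ℝ) < Δ := by exact_mod_cast hΔ0
  have b1 : ((h / (d * P) : ℕ) : ℝ) ≤ H / (d * P) := by
    refine Nat.cast_div_le.trans ?_
    push_cast
    gcongr
  have b2 : ((P / Δ : ℕ) : ℝ) ≤ P / Δ := Nat.cast_div_le
  have b3 : ((N / h : ℕ) : ℝ) + 1 ≤ 3 * (P * l ^ 6) := by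
    have hhR : (0 : ℝ) < h := by exact_mod_cast hh1
    have h1 : ((N / h : ℕ) : ℝ) ≤ 2 * (P * l ^ 6) := by
      refine Nat.cast_div_le.trans ?_
      rw [div_le_iff₀ hhR]
      have h2 : (N : ℝ) ≤ x := Nat.floor_le hx0
      have h3 : H * (P * l ^ 6) ≤ 2 * h * (P * l ^ 6) :=
        mul_le_mul_of_nonneg_right hhH' (by positivity)
      linarith
    have h2 : 1 ≤ P * l ^ 6 := one_le_mul_of_one_le_of_one_le hP1 (by linarith)
    linarith
  have b4 : (2 * Δ) * ((h / (d * P) : ℕ) + (P / Δ : ℕ) + 1) ≤ 26 * H / (d * l ^ 4) + 4 * P := by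
    have h1 : (2 * Δ : ℝ) * ((h / (d * P) : ℕ) + (P / Δ : ℕ) + 1) ≤
        2 * Δ * (H / (d * P) + P / Δ + 1) := by gcongr
    have h2 : (2 * Δ : ℝ) * (H / (d * P) + P / Δ + 1) = 2 * (Δ * (H / (d * P))) + 2 * P + 2 * Δ := by
      field_simp
    have h3 : (Δ : ℝ) * (H / (d * P)) ≤ 13 * P / l ^ 4 * (H / (d * P)) :=
      mul_le_mul_of_nonneg_right hΔup (by positivity)
    have h4 : 13 * P / l ^ 4 * (H / (d * P)) = 13 * H / (d * l ^ 4) := by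
      field_simp
    have h5 : 26 * H / (d * l ^ 4) = 2 * (13 * H / (d * l ^ 4)) := by ring
    linarith
  have b5 : (P : ℝ) ^ 2 * l ^ 6 ≤ x / (d * l ^ 4) := by
    rw [le_div_iff₀ (by positivity)]
    calc (P : ℝ) ^ 2 * l ^ 6 * (d * l ^ 4) = d * P ^ 2 * l ^ 10 := by ring
      _ ≤ x := hxd
  have b6 : (26 * H / (d * l ^ 4) + 4 * P) * (3 * (P * l ^ 6)) =
      78 * (x / (d * l ^ 4)) + 12 * (P ^ 2 * l ^ 6) := by
    rw [hxH]; ring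
  have b7 : 0 ≤ x / (d * l ^ 4) := by positivity
  calc (S.card : ℝ) ≤ _ := hcardR
    _ ≤ (26 * H / (d * l ^ 4) + 4 * P) * (3 * (P * l ^ 6)) :=
        mul_le_mul b4 b3 (by positivity) (by positivity)
    _ ≤ 156 * (x / (d * l ^ 4)) := by rw [b6]; linarith
    _ = 156 * x / (d * l ^ 4) := by ring

/-- A subset of `A₂` on which the totient is nondecreasing has at most `938 x / (log x)²`
elements. -/
lemma card_le_of_totient_monotone {x : ℝ} (hx : Real.exp 100 ≤ x) (B : Finset ℕ)
    (hB : ∀ n ∈ B, (n : ℝ) ≤ x ∧ inA2 x n)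
    (hφ : ∀ m ∈ B, ∀ n ∈ B, m ≤ n → Nat.totient m ≤ Nat.totient n) :
    (B.card : ℝ) ≤ 938 * x / (Real.log x) ^ 2 := by
  classical
  have hx0 : 0 < x := (Real.exp_pos _).trans_le hx
  set l := Real.log x with hl_def
  have hl : 100 ≤ l := (Real.le_log_iff_exp_le hx0).2 hx
  have hl0 : 0 < l := by linarith
  have hrep : ∀ n ∈ B, ∃ d p s : ℕ, IsRep (l ^ 10) n d p s := fun n hn => (hB n hn).2
  choose! d p s hdps using hrep
  set B₁ := B.filter (fun n : ℕ => (n : ℝ) < x / l ^ 2) with hB₁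
  set B₂ := B.filter (fun n : ℕ => ¬ (n : ℝ) < x / l ^ 2) with hB₂
  have hsplit : B₁.card + B₂.card = B.card := by
    simpa only [hB₁, hB₂] using
      Finset.card_filter_add_card_filter_not (s := B) (fun n : ℕ => (n : ℝ) < x / l ^ 2)
  set N : ℕ := ⌊x⌋₊ with hN
  have hl2x : l ^ 2 ≤ x := by
    have h1 : l ^ 3 / (Nat.factorial 3 : ℝ) ≤ x := by
      simpa [hl_def, Real.exp_log hx0] using Real.pow_div_factorial_le_exp l hl0.le 3
    have h2 : (Nat.factorial 3 : ℝ) = 6 := by norm_num [Nat.factorial]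
    rw [h2] at h1
    nlinarith [mul_le_mul_of_nonneg_left hl (sq_nonneg l)]
  have c1 : (B₁.card : ℝ) ≤ 2 * (x / l ^ 2) := by
    have h1 : B₁ ⊆ Finset.range (⌊x / l ^ 2⌋₊ + 1) := by
      intro n hn
      rw [hB₁, Finset.mem_filter] at hn
      rw [Finset.mem_range]
      exact Nat.lt_succ_of_le (Nat.le_floor hn.2.le)
    have h2 := Finset.card_le_card h1
    rw [Finset.card_range] at h2
    have h3 : (B₁.card : ℝ) ≤ ⌊x / l ^ 2⌋₊ + 1 := by exact_mod_cast h2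
    have h4 : (⌊x / l ^ 2⌋₊ : ℝ) ≤ x / l ^ 2 := Nat.floor_le (by positivity)
    have h5 : 1 ≤ x / l ^ 2 := by rwa [le_div_iff₀ (by positivity), one_mul]
    linarith
  have hmaps : ∀ n ∈ B₂, (d n, Nat.log 2 (p n)) ∈
      Finset.Icc 1 N ×ˢ Finset.range (Nat.log 2 N + 1) := by
    intro n hn
    have hnB := (Finset.mem_filter.1 hn).1
    have hr := hdps n hnB
    have hn0 : n ≤ N := Nat.le_floor (hB n hnB).1
    have hs0 : 0 < s n := by
      have h1 : (0 : ℝ) < s n := lt_of_le_of_lt (by positivity) hr.lt_s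
      exact_mod_cast h1
    have hnpos : 0 < n := by
      rw [hr.1]; exact Nat.mul_pos (Nat.mul_pos hr.d_pos hr.2.1.pos) hs0
    have hdn : d n ∣ n := ⟨p n * s n, by rw [← mul_assoc]; exact hr.1⟩
    have hpn : p n ∣ n := ⟨d n * s n, by
      conv_lhs => rw [hr.1]
      ring⟩
    simp only [Finset.mem_product, Finset.mem_Icc, Finset.mem_range]
    exact ⟨⟨hr.d_pos, (Nat.le_of_dvd hnpos hdn).trans hn0⟩,
      Nat.lt_succ_of_le (Nat.log_mono_right ((Nat.le_of_dvd hnpos hpn).trans hn0))⟩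
  have c2 : (B₂.card : ℝ) ≤ ∑ e ∈ Finset.Icc 1 N, ∑ _k ∈ Finset.range (Nat.log 2 N + 1),
      156 * x / (e * l ^ 4) := by
    rw [Finset.card_eq_sum_card_fiberwise hmaps, Nat.cast_sum, ← Finset.sum_product']
    refine Finset.sum_le_sum ?_
    rintro ⟨e, k⟩ hek
    simp only [Finset.mem_product, Finset.mem_Icc] at hek
    have hmem : ∀ n ∈ B₂.filter (fun n => (d n, Nat.log 2 (p n)) = (e, k)),
        n ∈ B ∧ x / l ^ 2 ≤ n ∧ d n = e ∧ Nat.log 2 (p n) = k := by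
      intro n hn
      simpa [hB₂, and_assoc] using hn
    refine card_le_of_fixed_d_and_dyadic hl _ p s (d := e) (P := 2 ^ k) ?_ ?_ ?_ ?_ hek.1.1 hx0.le
    · intro n hn
      obtain ⟨h1, -, h2, -⟩ := hmem n hn
      rw [← h2]
      exact hdps n h1
    · intro n hn
      obtain ⟨h1, -, -, h2⟩ := hmem n hn
      have hp0 : p n ≠ 0 := (hdps n h1).2.1.ne_zero
      rw [← h2]
      refine ⟨Nat.pow_log_le_self 2 hp0, ?_⟩
      have := Nat.lt_pow_succ_log_self (b := 2) (by norm_num) (p n)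
      rw [pow_succ] at this
      omega
    · intro n hn
      obtain ⟨h1, h2, -⟩ := hmem n hn
      exact ⟨h2, (hB n h1).1⟩
    · intro m hm n hn
      exact hφ m (hmem m hm).1 n (hmem n hn).1
  have hN1 : 1 ≤ N := Nat.le_floor (by
    have := Real.one_le_exp (show (0 : ℝ) ≤ 100 by norm_num)
    push_cast
    linarith)
  have hNx : (N : ℝ) ≤ x := Nat.floor_le hx0.le
  have hNR : (1 : ℝ) ≤ N := by exact_mod_cast hN1
  have hlogN : Real.log N ≤ l := Real.log_le_log (by linarith) hNx
  have c3 : (∑ e ∈ Finset.Icc 1 N, ((e : ℝ))⁻¹) ≤ 2 * l := by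
    have h1 := harmonic_le_one_add_log N
    rw [harmonic_eq_sum_Icc] at h1
    push_cast at h1
    linarith
  have c4 : ((Nat.log 2 N + 1 : ℕ) : ℝ) ≤ 3 * l := by
    have h1 : ((2 ^ Nat.log 2 N : ℕ) : ℝ) ≤ N := by
      exact_mod_cast Nat.pow_log_le_self 2 (by omega)
    have h2 := Real.log_le_log (by positivity) h1
    push_cast at h2
    rw [Real.log_pow] at h2
    have h3 := Real.log_two_gt_d9
    have h4 : (0 : ℝ) ≤ Nat.log 2 N := by positivity
    push_cast
    nlinarith
  have c5 : (∑ e ∈ Finset.Icc 1 N, ∑ _k ∈ Finset.range (Nat.log 2 N + 1),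
      156 * x / ((e : ℝ) * l ^ 4)) =
      156 * x / l ^ 4 * (((Nat.log 2 N + 1 : ℕ) : ℝ) * ∑ e ∈ Finset.Icc 1 N, ((e : ℝ))⁻¹) := by
    simp only [Finset.sum_const, Finset.card_range, nsmul_eq_mul, Finset.mul_sum]
    refine Finset.sum_congr rfl fun e _ => ?_
    rw [div_mul_eq_div_div_swap]
    ring
  have c6 : ((Nat.log 2 N + 1 : ℕ) : ℝ) * ∑ e ∈ Finset.Icc 1 N, ((e : ℝ))⁻¹ ≤ 3 * l * (2 * l) :=
    mul_le_mul c4 c3 (by positivity) (by positivity)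
  have c7 : (B₂.card : ℝ) ≤ 156 * x / l ^ 4 * (3 * l * (2 * l)) := by
    rw [c5] at c2
    exact c2.trans (mul_le_mul_of_nonneg_left c6 (by positivity))
  have c8 : 156 * x / l ^ 4 * (3 * l * (2 * l)) = 936 * (x / l ^ 2) := by
    field_simp; norm_num
  have c9 : (B.card : ℝ) = B₁.card + B₂.card := by exact_mod_cast hsplit.symm
  rw [c9, mul_div_assoc]
  linarith

theorem stmt9 : ∃ C : ℝ, 0 < C ∧ ∃ x₀ : ℝ, ∀ x : ℝ, x₀ ≤ x →
    (M {n : ℕ | (n : ℝ) ≤ x ∧ inA2 x n} : ℝ) ≤ C * x / (Real.log x) ^ 2 := by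
  refine ⟨938, by norm_num, Real.exp 100, fun x hx => ?_⟩
  have hx0 : 0 < x := (Real.exp_pos _).trans_le hx
  have hle : M {n : ℕ | (n : ℝ) ≤ x ∧ inA2 x n} ≤ ⌊938 * x / (Real.log x) ^ 2⌋₊ := by
    refine csSup_le ⟨0, ∅, by simp, by simp, rfl⟩ ?_
    rintro k ⟨B, hB, hφ, rfl⟩
    exact Nat.le_floor (card_le_of_totient_monotone hx B (fun n hn => hB hn) hφ)
  exact (Nat.cast_le.2 hle).trans (Nat.floor_le (by positivity))
end
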